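/- Let (R, 𝔪, K) be a d-dimensional local ring containing a field. Then λ_{i,j}(R) = 0 whenever j > d or i > j. -/

import Mathlib

set_option synthInstance.maxHeartbeats 1000000
set_option maxHeartbeats 1000000

open CategoryTheory Opposite IsLocalRing



namespace LyuV

section P1

lemma dim_le_of_span {R : Type} [CommRing R] [IsNoetherianRing R] [IsLocalRing R] (s : Finset R)
    (hs : Ideal.span (s : Set R) = maximalIdeal R) : ringKrullDim R ≤ (s.card : WithBot ℕ∞) := by
  refine (ringKrullDim_le_spanFinrank_maximalIdeal R).trans ?_
  have h := Submodule.spanFinrank_span_le_ncard_of_finite (R := R) (s := (s : Set R)) s.finite_toSet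
  rw [Set.ncard_coe_finset] at h
  have h2 : (maximalIdeal R).spanFinrank ≤ s.card := by
    rw [← hs]; exact h
  exact_mod_cast h2

lemma max_quot {R : Type} [CommRing R] [IsLocalRing R] (J : Ideal R) (hJ : J ≤ maximalIdeal R)
    [IsLocalRing (R ⧸ J)] (s : Set R)
    (hs : Ideal.span s ⊔ J = maximalIdeal R) :
    Ideal.span ((Ideal.Quotient.mk J) '' s) = maximalIdeal (R ⧸ J) := by
  rw [← map_maximalIdeal_of_surjective (Ideal.Quotient.mk J) Ideal.Quotient.mk_surjective, ← hs,
    Ideal.map_sup, Ideal.map_quotient_self, sup_bot_eq, Ideal.map_span]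

lemma quot_local {R : Type} [CommRing R] [IsLocalRing R] (J : Ideal R) (hJ : J ≤ maximalIdeal R) :
    IsLocalRing (R ⧸ J) := by
  have : Nontrivial (R ⧸ J) := Ideal.Quotient.nontrivial_iff.mpr (fun h => by
    rw [h] at hJ; exact (maximalIdeal.isMaximal R).ne_top (top_le_iff.mp hJ))
  exact IsLocalRing.of_surjective' (Ideal.Quotient.mk J) Ideal.Quotient.mk_surjective

lemma sub_jac {R : Type} [CommRing R] [IsLocalRing R] :
   Ring.jacobson R = maximalIdeal R := by
  exact IsLocalRing.ringJacobson_eq_maximalIdeal R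

lemma cancel_aux (a b : ℕ) (e : WithBot ℕ∞) (h : ((a + b : ℕ) : WithBot ℕ∞) ≤ e + (b : ℕ)) :
    (a : WithBot ℕ∞) ≤ e := by
  induction e using WithBot.recBotCoe with
  | bot =>
    rw [WithBot.bot_add] at h
    exact absurd (le_bot_iff.mp h) (by exact WithBot.natCast_ne_bot _)
  | coe e =>
    have h9 : ((a:ℕ∞) + b) ≤ e + b := by exact_mod_cast h
    have : (a:ℕ∞) ≤ e := by
      exact (ENat.add_le_add_iff_right (by simp)).mp h9
    exact_mod_cast this

open Classical in
lemma reg_domain (n : ℕ) : ∀ (R : Type) [CommRing R] [IsNoetherianRing R] [IsLocalRing R]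
    (s : Finset R), s.card ≤ n → Ideal.span (s : Set R) = maximalIdeal R →
    (n : WithBot ℕ∞) ≤ ringKrullDim R → IsDomain R := by
  induction n with
  | zero =>
    intro R _ _ _ s hs hspan _
    have : s = ∅ := by simpa using hs
    subst this
    have hb : maximalIdeal R = ⊥ := by rw [← hspan]; simp
    have := (isField_iff_maximalIdeal_eq (R := R)).mpr hb
    exact this.isDomain
  | succ n ih =>
    intro R _ _ _ s hs hspan hdim
    -- choose x
    have hfin : (minimalPrimes R).Finite := minimalPrimes.finite_of_isNoetherianRing R
    have key : ∃ x ∈ maximalIdeal R, x ∉ (maximalIdeal R)^2 ∧ ∀ p ∈ minimalPrimes R, x ∉ p := by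
      by_contra hcon
      push Not at hcon
      have hsub : ((maximalIdeal R : Ideal R) : Set R) ⊆
          ⋃ i ∈ ((insert ((maximalIdeal R)^2) hfin.toFinset : Finset (Ideal R)) : Set (Ideal R)), (id i : Ideal R) := by
        intro x hx
        by_cases h2 : x ∈ (maximalIdeal R)^2
        · exact Set.mem_biUnion (x := (maximalIdeal R)^2) (by simp) h2
        · obtain ⟨p, hp, hxp⟩ := hcon x hx h2
          exact Set.mem_biUnion (x := p) (by simp [hp]) hxp
      rw [Ideal.subset_union_prime ((maximalIdeal R)^2) ((maximalIdeal R)^2)] at hsub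
      · obtain ⟨p, hp, hle⟩ := hsub
        have hpos : ¬ (ringKrullDim R ≤ 0) := by
          intro h0
          have := hdim.trans h0
          have h3 : n + 1 ≤ 0 := by exact_mod_cast this
          omega
        rw [Finset.mem_insert] at hp
        rcases hp with rfl | hp
        · apply hpos
          have : maximalIdeal R = ⊥ := by
            apply Submodule.eq_bot_of_le_smul_of_le_jacobson_bot (maximalIdeal R) (maximalIdeal R)
              (IsNoetherian.noetherian _)
            · simpa [pow_two] using hle
            · rw [IsLocalRing.jacobson_eq_maximalIdeal ⊥ bot_ne_top]
          have h4 := dim_le_of_span (R := R) ∅ (by simp [this])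
          simpa using h4
        · apply hpos
          have hp' : p ∈ minimalPrimes R := by simpa using hp
          have hpp : p.IsPrime := hp'.1.1
          have : p = maximalIdeal R := le_antisymm (IsLocalRing.le_maximalIdeal hpp.ne_top) hle
          rw [← IsLocalRing.maximalIdeal_height_eq_ringKrullDim, ← this, Ideal.height_eq_zero_iff.mpr hp']
          rfl
      · intro i hi h1 _
        rw [Finset.mem_insert] at hi
        rcases hi with rfl | hi
        · exact absurd rfl h1
        · have hp' : i ∈ minimalPrimes R := by simpa using hi
          exact hp'.1.1
    obtain ⟨x, hxm, hx2, hxp⟩ := key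
    have hx3 := hxm
    rw [← hspan, Submodule.mem_span_finset'] at hx3
    obtain ⟨a, ha⟩ := hx3
    have : ∃ i, IsUnit (a i) := by
      by_contra hcon
      push Not at hcon
      apply hx2
      rw [← ha]
      refine Ideal.sum_mem _ (fun i _ => ?_)
      rw [pow_two]
      exact Ideal.mul_mem_mul ((mem_maximalIdeal _).mpr (hcon i))
        (by rw [← hspan]; exact Ideal.subset_span i.2)
    obtain ⟨i, u, hu⟩ := this
    have hJ : Ideal.span {x} ≤ maximalIdeal R := by
      rw [Ideal.span_le]; simpa using hxm
    have := quot_local _ hJ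
    have hs' : Ideal.span ((s.erase i.1 : Finset R) : Set R) ⊔ Ideal.span {x} = maximalIdeal R := by
      apply le_antisymm
      · refine sup_le ?_ hJ
        rw [← hspan]
        exact Ideal.span_mono (by simp)
      · rw [← hspan, Ideal.span_le]
        intro y hy
        by_cases hyi : y = i.1
        · have h5 : (a i) • (i : R) = x - ∑ k ∈ Finset.univ.erase i, a k • (k : R) := by
            rw [← ha, ← Finset.add_sum_erase _ _ (Finset.mem_univ i)]
            ring
          have h6 : (a i) • (i : R) ∈ Ideal.span ((s.erase i.1 : Finset R) : Set R) ⊔ Ideal.span {x} := by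
            rw [h5]
            refine Ideal.sub_mem _ (Ideal.mem_sup_right (Ideal.mem_span_singleton_self x)) ?_
            refine Ideal.mem_sup_left (Ideal.sum_mem _ fun k hk => Ideal.mul_mem_left _ _ (Ideal.subset_span ?_))
            simp only [Finset.coe_erase, Set.mem_sdiff, Finset.mem_coe, Set.mem_singleton_iff]
            refine ⟨k.2, fun h => ?_⟩
            exact (Finset.ne_of_mem_erase hk) (Subtype.ext h)
          have h7 := Ideal.mul_mem_left _ (↑u⁻¹ : R) h6
          rw [smul_eq_mul, ← mul_assoc, ← hu, Units.inv_mul, one_mul] at h7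
          rw [hyi]; exact h7
        · refine Ideal.mem_sup_left (Ideal.subset_span ?_)
          simpa [hyi] using hy
    have h1 := max_quot _ hJ _ hs'
    rw [← Finset.coe_image] at h1
    have hcard : ((s.erase i.1).image (Ideal.Quotient.mk (Ideal.span {x}))).card ≤ n := by
      refine Finset.card_image_le.trans ?_
      rw [Finset.card_erase_of_mem i.2]; omega
    have hd : (n : WithBot ℕ∞) ≤ ringKrullDim (R ⧸ Ideal.span {x}) := by
      have := ringKrullDim_le_ringKrullDim_quotient_add_card ({x} : Finset R) (by
        rw [sub_jac]; simpa using hxm)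
      have h8 := hdim.trans this
      rw [Finset.coe_singleton, Finset.card_singleton] at h8
      exact cancel_aux n 1 _ h8
    have hdom := ih _ _ hcard h1 hd
    have hprime : (Ideal.span {x}).IsPrime := (Ideal.Quotient.isDomain_iff_prime _).mp hdom
    obtain ⟨p, hp, hple⟩ := Ideal.exists_minimalPrimes_le (I := (⊥ : Ideal R)) (J := Ideal.span {x}) bot_le
    have hpp : p.IsPrime := hp.1.1
    have hxnp := hxp p hp
    have : p = ⊥ := by
      apply Submodule.eq_bot_of_le_smul_of_le_jacobson_bot (Ideal.span {x}) p
              (IsNoetherian.noetherian _)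
      · intro y hy
        obtain ⟨z, rfl⟩ := Ideal.mem_span_singleton'.mp (hple hy)
        have : z ∈ p := (hpp.mem_or_mem hy).resolve_right hxnp
        rw [mul_comm]
        exact Ideal.mul_mem_mul (Ideal.mem_span_singleton_self x) this
      · rw [IsLocalRing.jacobson_eq_maximalIdeal ⊥ bot_ne_top]; exact hJ
    rw [this] at hpp
    exact IsDomain.of_bot_isPrime R

/-- regular system of parameters -/
structure RSP (R : Type) [CommRing R] [IsLocalRing R] (n : ℕ) (x : Fin n → R) : Prop where
  span : Ideal.span (Set.range x) = maximalIdeal R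
  dim : (n : WithBot ℕ∞) ≤ ringKrullDim R

variable {R : Type} [CommRing R] [IsNoetherianRing R] [IsLocalRing R] {n : ℕ} {x : Fin n → R}

lemma RSP.mem (h : RSP R n x) (i : Fin n) : x i ∈ maximalIdeal R := by
  rw [← h.span]; exact Ideal.subset_span ⟨i, rfl⟩

lemma RSP.le (h : RSP R n x) (A : Set (Fin n)) : Ideal.span (x '' A) ≤ maximalIdeal R := by
  rw [← h.span]; exact Ideal.span_mono (Set.image_subset_range _ _)

open Classical in
lemma RSP.dim_quot (h : RSP R n x) (A : Finset (Fin n)) :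
    ((n - A.card : ℕ) : WithBot ℕ∞) ≤ ringKrullDim (R ⧸ Ideal.span (x '' A)) := by
  have := ringKrullDim_le_ringKrullDim_quotient_add_card (A.image x) (by
        rw [sub_jac]; intro y hy
        simp only [Finset.coe_image, Set.mem_image, Finset.mem_coe] at hy
        obtain ⟨i, _, rfl⟩ := hy
        exact h.mem i)
  have h8 := h.dim.trans this
  rw [Finset.coe_image] at h8
  refine cancel_aux _ A.card _ ?_
  have hA : A.card ≤ n := by simpa using A.card_le_univ
  rw [Nat.sub_add_cancel hA]
  refine h8.trans ?_
  gcongr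
  exact Finset.card_image_le

open Classical in
lemma RSP.span_quot (h : RSP R n x) (A : Finset (Fin n)) [IsLocalRing (R ⧸ Ideal.span (x '' A))] :
    Ideal.span ((Aᶜ.image (fun i => Ideal.Quotient.mk (Ideal.span (x '' A)) (x i)) : Finset _) : Set
      (R ⧸ Ideal.span (x '' A))) = maximalIdeal (R ⧸ Ideal.span (x '' A)) := by
  have := max_quot (Ideal.span (x '' A)) (h.le _) (x '' (Aᶜ : Finset _)) (by
    rw [← Ideal.span_union, ← Set.image_union, ← h.span]; simp)
  rw [Finset.coe_image, ← this, Set.image_image]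

open Classical in
lemma RSP.prime (h : RSP R n x) (A : Finset (Fin n)) : (Ideal.span (x '' A)).IsPrime := by
  rw [← Ideal.Quotient.isDomain_iff_prime]
  have := quot_local _ (h.le (A : Set (Fin n)))
  refine reg_domain (n - A.card) _ _ ?_ (h.span_quot A) (h.dim_quot A)
  refine Finset.card_image_le.trans ?_
  rw [Finset.card_compl, Fintype.card_fin]

open Classical in
lemma RSP.notMem (h : RSP R n x) (A : Finset (Fin n)) (i : Fin n) (hi : i ∉ A) :
    x i ∉ Ideal.span (x '' A) := by
  intro hmem
  have heq : Ideal.span (x '' (insert i A : Finset (Fin n))) = Ideal.span (x '' A) := by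
    apply le_antisymm
    · rw [Ideal.span_le, Finset.coe_insert, Set.image_insert_eq, Set.insert_subset_iff]
      exact ⟨hmem, Ideal.subset_span⟩
    · exact Ideal.span_mono (Set.image_mono (by simp))
  have := quot_local _ (h.le ((insert i A : Finset (Fin n)) : Set (Fin n)))
  have h1 := dim_le_of_span _ (h.span_quot (insert i A))
  have h2 := h.dim_quot A
  rw [← heq] at h2
  have h3 := h2.trans h1
  have h4 : n - A.card ≤ n - (A.card + 1) := by
    refine le_trans (by exact_mod_cast h3) (Finset.card_image_le.trans ?_)
    rw [Finset.card_compl, Fintype.card_fin, Finset.card_insert_of_notMem hi]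
  have h5 : A.card + 1 ≤ n := by
    rw [← Finset.card_insert_of_notMem hi]
    simpa using (insert i A).card_le_univ
  omega

lemma RSP.colon (h : RSP R n x) (A : Finset (Fin n)) (i : Fin n) (hi : i ∉ A) (y : R)
    (hy : x i * y ∈ Ideal.span (x '' A)) : y ∈ Ideal.span (x '' A) :=
  ((h.prime A).mem_or_mem hy).resolve_left (h.notMem A i hi)

/-- ideal generated by powers -/
def powI (x : Fin n → R) (A : Finset (Fin n)) (e : Fin n → ℕ) : Ideal R :=
  Ideal.span ((fun i => x i ^ e i) '' A)

open Classical in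
lemma RSP.colon_pow (h : RSP R n x) (N : ℕ) : ∀ (A : Finset (Fin n)) (e : Fin n → ℕ) 
    (_ : ∀ i ∈ A, 1 ≤ e i) (_ : ∑ i ∈ A, (e i - 1) = N) (i : Fin n) (_ : i ∉ A) (y : R)
    (_ : x i * y ∈ powI x A e), y ∈ powI x A e := by
  induction N using Nat.strong_induction_on with
  | _ N ih =>
  intro A e he hN i hi y hy
  by_cases hall : ∀ k ∈ A, e k = 1
  · have : powI x A e = Ideal.span (x '' A) := by
      unfold powI
      congr 1
      exact Set.image_congr (fun k hk => by rw [hall k hk, pow_one])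
    rw [this] at hy ⊢
    exact h.colon A i hi y hy
  · push Not at hall
    obtain ⟨k, hk, hek⟩ := hall
    have hek2 : 2 ≤ e k := by have := he k hk; omega
    have hik : i ≠ k := fun h => hi (h ▸ hk)
    obtain ⟨B, hB, rfl⟩ : ∃ B, k ∉ B ∧ insert k B = A :=
      ⟨A.erase k, Finset.notMem_erase k A, Finset.insert_erase hk⟩
    -- decomposition
    have hdec : ∀ (c : ℕ) (z : R), z ∈ powI x (insert k B) (Function.update e k c) ↔
        ∃ a b, b ∈ powI x B e ∧ z = a * x k ^ c + b := by
      intro c z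
      have : powI x (insert k B) (Function.update e k c) = Ideal.span (insert (x k ^ c) ((fun i => x i ^ e i) '' B)) := by
        unfold powI
        rw [Finset.coe_insert, Set.image_insert_eq]
        congr 2
        · simp
        · refine Set.image_congr (fun l hl => ?_)
          have : l ≠ k := fun h => hB (h ▸ hl)
          simp [Function.update_of_ne this]
      rw [this, Ideal.mem_span_insert]
      simp only [powI]
    have hsum : ∀ c, ∑ l ∈ insert k B, (Function.update e k c l - 1) = (c - 1) + ∑ l ∈ B, (e l - 1) := by
      intro c
      rw [Finset.sum_insert hB]
      congr 1
      · simp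
      · refine Finset.sum_congr rfl fun l hl => ?_
        have : l ≠ k := fun h => hB (h ▸ hl)
        simp [Function.update_of_ne this]
    have hge : ∀ c, 1 ≤ c → ∀ l ∈ insert k B, 1 ≤ Function.update e k c l := by
      intro c hc l hl
      by_cases hlk : l = k
      · subst hlk; simpa using hc
      · simp [Function.update_of_ne hlk]; exact he l hl
    have hupd : Function.update e k (e k) = e := Function.update_eq_self k e
    have hN' : (e k - 1) + ∑ l ∈ B, (e l - 1) = N := by
      rw [← hN, Finset.sum_insert hB]
    rw [← hupd, hdec] at hy
    obtain ⟨a, b, hb, hab⟩ := hy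
    -- step 1: y in the ideal with exponent e k - 1
    have h1 : y ∈ powI x (insert k B) (Function.update e k (e k - 1)) := by
      refine ih (N - 1) (by omega) _ _ (hge _ (by omega)) ?_ i hi y ?_
      · rw [hsum]; omega
      · rw [hdec]
        refine ⟨a * x k, b, hb, ?_⟩
        rw [hab, mul_assoc, ← pow_succ', Nat.sub_add_cancel (by omega)]
    obtain ⟨a', b', hb', hab'⟩ := (hdec _ _).mp h1
    -- product with a power of the variable lies in powI B
    have h2 : ∀ c, x k ^ c * (x i * a' - a * x k) ∈ powI x B e → x i * a' - a * x k ∈ powI x B e := by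
      intro c
      induction c with
      | zero => simp
      | succ c ihc =>
        intro hc
        apply ihc
        refine ih (∑ l ∈ B, (e l - 1)) (by omega) B e (fun l hl => he l (by simp [hl])) rfl k hB _ ?_
        rw [← mul_assoc, ← pow_succ']; exact hc
    have h3 := h2 (e k - 1) (by
      have : x k ^ (e k - 1) * (x i * a' - a * x k) = b - x i * b' := by
        have hpow : x k ^ (e k) = x k ^ (e k - 1) * x k := by
          rw [← pow_succ, Nat.sub_add_cancel (by omega)]
        rw [hab', hpow] at hab
        linear_combination hab
      rw [this]
      exact Ideal.sub_mem _ hb (Ideal.mul_mem_left _ _ hb'))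
    have h4 : a' ∈ powI x (insert k B) (Function.update e k 1) := by
      refine ih (∑ l ∈ B, (e l - 1)) (by omega) _ _ (hge 1 le_rfl) ?_ i hi a' ?_
      · rw [hsum]; omega
      · rw [hdec]
        exact ⟨a, _, h3, by ring⟩
    obtain ⟨a'', b'', hb'', hab''⟩ := (hdec _ _).mp h4
    rw [← hupd, hdec]
    refine ⟨a'', b'' * x k ^ (e k - 1) + b', Ideal.add_mem _ (Ideal.mul_mem_right _ _ hb'') hb', ?_⟩
    have hpow : x k ^ (e k) = x k ^ (e k - 1) * x k := by
      rw [← pow_succ, Nat.sub_add_cancel (by omega)]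
    rw [hab', hab'', hpow]; ring

open Classical in
lemma RSP.monomial_notMem (h : RSP R n x) (β : Fin n → ℕ) (B : Finset (Fin n)) :
    ∏ i ∈ B, x i ^ β i ∉ powI x Finset.univ (fun i => if i ∈ B then β i + 1 else 1) := by
  induction B using Finset.induction_on with
  | empty =>
    intro hmem
    have : powI x Finset.univ (fun i => if i ∈ (∅ : Finset (Fin n)) then β i + 1 else 1) = maximalIdeal R := by
      rw [← h.span]; simp [powI]
    rw [this] at hmem
    simp at hmem
  | insert k B hk ih =>
    intro hmem
    apply ih
    have hdec : ∀ (f : Fin n → ℕ) (z : R), z ∈ powI x Finset.univ f ↔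
        ∃ a b, b ∈ powI x (Finset.univ.erase k) f ∧ z = a * x k ^ (f k) + b := by
      intro f z
      have : powI x Finset.univ f = Ideal.span (insert (x k ^ f k) ((fun i => x i ^ f i) '' (Finset.univ.erase k : Finset (Fin n)))) := by
        unfold powI
        conv_lhs => rw [← Finset.insert_erase (Finset.mem_univ k), Finset.coe_insert, Set.image_insert_eq]
      rw [this, Ideal.mem_span_insert]
      simp only [powI]
    have hcongr : powI x (Finset.univ.erase k) (fun i => if i ∈ insert k B then β i + 1 else 1) =
        powI x (Finset.univ.erase k) (fun i => if i ∈ B then β i + 1 else 1) := by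
      unfold powI
      congr 1
      refine Set.image_congr (fun l hl => ?_)
      have : l ≠ k := by simpa using hl
      simp [this]
    rw [hdec] at hmem
    obtain ⟨a, b, hb, hab⟩ := hmem
    rw [hcongr] at hb
    rw [Finset.prod_insert hk] at hab
    simp only [Finset.mem_insert_self, if_true] at hab
    rw [hdec]
    refine ⟨a, ∏ i ∈ B, x i ^ β i - a * x k, ?_, by simp [hk]⟩
    have h2 : ∀ c w, x k ^ c * w ∈ powI x (Finset.univ.erase k) (fun i => if i ∈ B then β i + 1 else 1) →
        w ∈ powI x (Finset.univ.erase k) (fun i => if i ∈ B then β i + 1 else 1) := by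
      intro c w
      induction c with
      | zero => simp
      | succ c ihc =>
        intro hc
        apply ihc
        refine h.colon_pow _ _ _ (fun l _ => by split_ifs <;> omega) rfl k (by simp) _ ?_
        rw [← mul_assoc, ← pow_succ']; exact hc
    refine h2 (β k) _ ?_
    have : x k ^ β k * (∏ i ∈ B, x i ^ β i - a * x k) = b := by
      rw [pow_succ] at hab
      linear_combination hab
    rw [this]; exact hb

lemma RSP.monomial_notMem' (h : RSP R n x) (β : Fin n → ℕ) :
    ∏ i, x i ^ β i ∉ Ideal.span (Set.range fun i => x i ^ (β i + 1)) := by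
  have := h.monomial_notMem β Finset.univ
  simpa [powI] using this

end P1
end LyuV



namespace LyuV

section P2a
open Algebra MvPolynomial

lemma crit {F0 K : Type} [Field F0] [Field K] [Algebra F0 K] :
    Subsingleton (Algebra.H1Cotangent F0 K) ↔
    ∀ f : MvPolynomial K F0, aeval id f = (0:K) → (∀ k, aeval id (pderiv k f) = (0:K)) →
      f ∈ (RingHom.ker (aeval (R := F0) (id : K → K)))^2 := by
  haveI : FormallySmooth F0 (Generators.self F0 K).toExtension.Ring :=
    (inferInstance : FormallySmooth F0 (MvPolynomial K F0))
  rw [← Extension.cotangentComplex_injective_iff (Generators.self F0 K).toExtension]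
  rw [injective_iff_map_eq_zero]
  have hker : (Generators.self F0 K).toExtension.ker = RingHom.ker (aeval (R := F0) (id : K → K)) := by
    rfl
  have key : ∀ f : (Generators.self F0 K).toExtension.ker, (Generators.self F0 K).toExtension.cotangentComplex (.mk f) = 0 ↔ 
     (∀ k, aeval id (pderiv k (f.1 : MvPolynomial K F0)) = (0:K)) := by
    intro f
    rw [Extension.cotangentComplex_mk, ← (Generators.self F0 K).cotangentSpaceBasis.repr.map_eq_zero_iff, Finsupp.ext_iff]
    refine forall_congr' fun k => ?_
    rw [(Generators.self F0 K).cotangentSpaceBasis_repr_one_tmul]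
    rfl
  have key2 : ∀ f : (Generators.self F0 K).toExtension.ker,
     (Extension.Cotangent.mk f = 0 ↔ f.1 ∈ (RingHom.ker (aeval (R := F0) (id : K → K)))^2) := by
    intro f
    rw [Extension.Cotangent.mk_eq_zero_iff]
    rfl
  constructor
  · intro h f hf hd
    exact (key2 ⟨f, hf⟩).mp (h _ ((key ⟨f, hf⟩).mpr hd))
  · intro h a ha
    obtain ⟨f, rfl⟩ := Extension.Cotangent.mk_surjective a
    exact (key2 f).mpr (h f.1 f.2 ((key f).mp ha))

lemma pderiv_rename' {σ τ R : Type} [CommRing R] (g : σ → τ) (hg : Function.Injective g) (i : σ) (p : MvPolynomial σ R) :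
    pderiv (g i) (rename g p) = rename g (pderiv i p) := by
  classical
  induction p using MvPolynomial.induction_on with
  | C a => simp
  | add p q hp hq => simp [hp, hq]
  | mul_X p j hp =>
    simp only [map_mul, rename_X, pderiv_mul, hp, map_add, pderiv_X]
    congr 2
    by_cases h : i = j
    · subst h; simp
    · simp [Pi.single_apply, Ne.symm h, hg.ne (Ne.symm h), hg.eq_iff]

open Classical in
theorem formallySmooth_perfect (F0 K : Type) [Field F0] [PerfectField F0] [Field K] [Algebra F0 K] :
    Algebra.FormallySmooth F0 K := by
  refine ⟨inferInstance, ?_⟩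
  rw [crit]
  intro f hf hd
  obtain ⟨K', hK'⟩ : ∃ K' : IntermediateField F0 K, K' = IntermediateField.adjoin F0 (f.vars : Set K) := ⟨_, rfl⟩
  have hfg : EssFiniteType F0 K' := IntermediateField.essFiniteType_iff.mpr ⟨f.vars, hK'.symm⟩
  have hs : FormallySmooth F0 K' := .of_perfectField
  have hs2 := crit.mp hs.subsingleton_h1Cotangent
  obtain ⟨q, rfl⟩ := exists_rename_eq_of_vars_subset_range f (Subtype.val : K' → K) Subtype.val_injective
    (by intro y hy; exact ⟨⟨y, hK' ▸ IntermediateField.subset_adjoin _ _ hy⟩, rfl⟩)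
  have hcomm : ∀ p : MvPolynomial K' F0, aeval (R := F0) (id : K → K) (rename (Subtype.val : K' → K) p) = ((aeval id p : K') : K) := by
    intro p
    rw [aeval_rename]
    change aeval (fun k : K' => algebraMap K' K k) p = algebraMap K' K (aeval id p)
    rw [← aeval_algebraMap_apply]; rfl
  have hq : q ∈ (RingHom.ker (aeval (R := F0) (id : K' → K')))^2 := by
    apply hs2
    · apply Subtype.val_injective
      rw [hcomm] at hf
      exact hf
    · intro k
      have := hd k.1
      rw [pderiv_rename' _ Subtype.val_injective, hcomm] at this
      exact Subtype.val_injective this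
  have := Ideal.mem_map_of_mem (rename (R := F0) (Subtype.val : K' → K)) hq
  rw [Ideal.map_pow] at this
  refine Ideal.pow_right_mono ?_ 2 this
  rw [Ideal.map_le_iff_le_comap]
  intro p hp
  change aeval id (rename _ p) = (0 : K)
  rw [hcomm]
  rw [show aeval id p = (0 : K') from hp]; rfl

theorem exists_coeff_field_aux {S : Type} [CommRing S] [IsLocalRing S] (F0 : Type) [Field F0] [PerfectField F0] [Algebra F0 S] :
    ∃ g : ResidueField S →+* AdicCompletion (maximalIdeal S) S,
      ∀ a, AdicCompletion.evalOneₐ (maximalIdeal S) (g a) = a := by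
  have := formallySmooth_perfect F0 (ResidueField S)
  obtain ⟨g, hg⟩ := Algebra.FormallySmooth.exists_adicCompletionEvalOneₐ_comp_eq (R := F0) (S := S) (I := maximalIdeal S)
    (A := ResidueField S) (AlgHom.id F0 (ResidueField S))
  exact ⟨g, fun a => DFunLike.congr_fun hg a⟩

theorem exists_coeff_field {S : Type} [CommRing S] [IsLocalRing S] (F : Type) [Field F] [Algebra F S] :
    ∃ g : ResidueField S →+* AdicCompletion (maximalIdeal S) S,
      ∀ a, AdicCompletion.evalOneₐ (maximalIdeal S) (g a) = a := by
  obtain ⟨p, hp⟩ := CharP.exists F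
  rcases CharP.char_is_prime_or_zero F p with h | h
  · haveI : Fact p.Prime := ⟨h⟩
    letI : Algebra (ZMod p) F := ZMod.algebra F p
    letI : Algebra (ZMod p) S := ((algebraMap F S).comp (algebraMap (ZMod p) F)).toAlgebra
    exact exists_coeff_field_aux (ZMod p)
  · subst h
    haveI : CharZero F := CharP.charP_to_charZero F
    letI : Algebra ℚ S := ((algebraMap F S).comp (algebraMap ℚ F)).toAlgebra
    exact exists_coeff_field_aux ℚ
end P2a
end LyuV



namespace LyuV

section P2b
open MvPolynomial

structure CT (S : Type) [CommRing S] [IsLocalRing S] (T : Type) [CommRing T] [Algebra S T]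
    (K : Type) [Field K] (c : K →+* T) (M : Ideal T) : Prop where
  map : M = (maximalIdeal S).map (algebraMap S T)
  t1 : ∀ (z : T) (a : ℕ), ∃ s : S, z - algebraMap S T s ∈ M ^ a
  t2 : ∀ (s : S) (a : ℕ), algebraMap S T s ∈ M ^ a → s ∈ maximalIdeal S ^ a
  haus : ∀ z : T, (∀ a, z ∈ M ^ a) → z = 0
  prec : ∀ f : ℕ → T, (∀ a, f (a+1) - f a ∈ M ^ a) → ∃ L, ∀ a, L - f a ∈ M ^ a
  res : ∀ z : T, ∃ k, z - c k ∈ M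

variable {S : Type} [CommRing S] [IsNoetherianRing S] [IsLocalRing S] {n : ℕ} {x : Fin n → S}
  {T : Type} [CommRing T] [Algebra S T] {K : Type} [Field K] {c : K →+* T} {M : Ideal T}

/-- evaluation -/
noncomputable def ev (x : Fin n → S) (c : K →+* T) : MvPolynomial (Fin n) K →+* T :=
  eval₂Hom c (fun i => algebraMap S T (x i))

lemma CT.xmem (hT : CT S T K c M) (hx : RSP S n x) (i : Fin n) : algebraMap S T (x i) ∈ M := by
  rw [hT.map]; exact Ideal.mem_map_of_mem _ (hx.mem i)

lemma CT.span (hT : CT S T K c M) (hx : RSP S n x) :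
    M = Ideal.span (Set.range fun i => algebraMap S T (x i)) := by
  rw [hT.map, ← hx.span, Ideal.map_span, ← Set.range_comp]; rfl

lemma CT.ev_idealOfVars (hT : CT S T K c M) (hx : RSP S n x) (a : ℕ) (p : MvPolynomial (Fin n) K)
    (hp : p ∈ idealOfVars (Fin n) K ^ a) : ev (T := T) x c p ∈ M ^ a := by
  have h1 := Ideal.mem_map_of_mem (ev (T := T) x c) hp
  rw [Ideal.map_pow] at h1
  refine Ideal.pow_right_mono ?_ a h1
  rw [Ideal.map_le_iff_le_comap, idealOfVars, Ideal.span_le]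
  rintro _ ⟨i, rfl⟩
  simpa [ev] using hT.xmem hx i

lemma CT.approx_aux (hT : CT S T K c M) (hx : RSP S n x) (a : ℕ) : ∀ z ∈ M ^ a, ∃ p, z - ev x c p ∈ M ^ (a + 1) := by
  induction a with
  | zero =>
    intro z _
    obtain ⟨k, hk⟩ := hT.res z
    exact ⟨C k, by simpa [ev] using hk⟩
  | succ a ih =>
    intro z hz
    rw [pow_succ'] at hz
    induction hz using Submodule.mul_induction_on' with
    | mem_mul_mem u hu v hv =>
      obtain ⟨p, hp⟩ := ih v hv
      have hp' : ev x c p ∈ M ^ a := by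
        have := Ideal.sub_mem _ hv (Ideal.pow_le_pow_right (Nat.le_succ a) hp)
        simpa using this
      have : ∃ q, u - ev x c q ∈ M ^ 2 := by
        rw [hT.span hx, Ideal.mem_span_range_iff_exists_fun] at hu
        obtain ⟨t, rfl⟩ := hu
        choose k hk using fun i => hT.res (t i)
        refine ⟨∑ i, C (k i) * X i, ?_⟩
        rw [map_sum, ← Finset.sum_sub_distrib]
        refine Ideal.sum_mem _ fun i _ => ?_
        have : t i * algebraMap S T (x i) - ev x c (C (k i) * X i) = (t i - c (k i)) * algebraMap S T (x i) := by
          simp [ev]; ring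
        rw [this, pow_two]
        exact Ideal.mul_mem_mul (hk i) (hT.xmem hx i)
      obtain ⟨q, hq⟩ := this
      refine ⟨q * p, ?_⟩
      have : u * v - ev x c (q * p) = u * (v - ev x c p) + (u - ev x c q) * ev x c p := by
        rw [map_mul]; ring
      rw [this]
      refine Ideal.add_mem _ ?_ ?_
      · rw [pow_succ']; exact Ideal.mul_mem_mul hu hp
      · rw [show a + 1 + 1 = 2 + a by ring, pow_add]; exact Ideal.mul_mem_mul hq hp'
    | add y _ z _ hy hz =>
      obtain ⟨p, hp⟩ := hy
      obtain ⟨q, hq⟩ := hz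
      refine ⟨p + q, ?_⟩
      rw [map_add, add_sub_add_comm]
      exact Ideal.add_mem _ hp hq

lemma CT.approx (hT : CT S T K c M) (hx : RSP S n x) (z : T) (a : ℕ) : ∃ p, z - ev x c p ∈ M ^ a := by
  induction a with
  | zero => exact ⟨0, by simp⟩
  | succ a ih =>
    obtain ⟨p, hp⟩ := ih
    obtain ⟨q, hq⟩ := hT.approx_aux hx a _ hp
    exact ⟨p + q, by rw [map_add, ← sub_sub]; exact hq⟩

/-- monomials other than `β` of degree at least `|β|` lie in the ideal -/
lemma mono_mem {R : Type} [CommRing R] (y : Fin n → R) (β α : Fin n →₀ ℕ) (h : β.degree ≤ α.degree) (hne : α ≠ β) :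
    (∏ i, y i ^ α i) ∈ Ideal.span (Set.range fun i => y i ^ (β i + 1)) := by
  have : ∃ i, β i + 1 ≤ α i := by
    by_contra hcon
    push Not at hcon
    apply hne
    have hle : ∀ i, α i ≤ β i := fun i => by have := hcon i; omega
    rw [Finsupp.degree_eq_sum, Finsupp.degree_eq_sum] at h
    have := (Finset.sum_eq_sum_iff_of_le (fun i _ => hle i)).mp (le_antisymm (Finset.sum_le_sum fun i _ => hle i) h)
    ext i
    exact this i (Finset.mem_univ i)
  obtain ⟨i, hi⟩ := this
  rw [← Finset.mul_prod_erase _ _ (Finset.mem_univ i)]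
  refine Ideal.mul_mem_right _ _ ?_
  obtain ⟨k, hk⟩ := Nat.exists_eq_add_of_le hi
  rw [hk, pow_add]
  exact Ideal.mul_mem_right _ _ (Ideal.subset_span ⟨i, rfl⟩)

lemma RSP.pow_le (hx : RSP S n x) (β : Fin n →₀ ℕ) : maximalIdeal S ^ (β.degree + 1) ≤
    Ideal.span (Set.range fun i => x i ^ (β i + 1)) := by
  have h1 : maximalIdeal S = (idealOfVars (Fin n) S).map (aeval x : MvPolynomial (Fin n) S →ₐ[S] S) := by
    rw [idealOfVars, Ideal.map_span, ← hx.span, ← Set.range_comp]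
    congr 2
    ext i; simp
  rw [h1, ← Ideal.map_pow, pow_idealOfVars_eq_span, Ideal.map_span, Ideal.span_le]
  rintro _ ⟨_, ⟨α, hα, rfl⟩, rfl⟩
  have : α.degree = β.degree + 1 := by simpa using hα
  have h2 := mono_mem x β α (by omega) (by rintro rfl; omega)
  simpa [aeval_monomial, Finsupp.prod_fintype] using h2

lemma CT.quasi (hT : CT S T K c M) (hx : RSP S n x) (a : ℕ) (p : MvPolynomial (Fin n) K)
    (hp : ev x c p ∈ M ^ a) : p ∈ idealOfVars (Fin n) K ^ a := by
  rw [mem_pow_idealOfVars_iff]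
  by_contra hcon
  push Not at hcon
  obtain ⟨β0, hβ0, hlt0⟩ := hcon
  obtain ⟨β, hβ, hmin⟩ := Finset.exists_min_image p.support (fun β => β.degree) ⟨β0, hβ0⟩
  have hlt : β.degree < a := lt_of_le_of_lt (hmin β0 hβ0) hlt0
  let J : Ideal S := Ideal.span (Set.range fun i => x i ^ (β i + 1))
  have hJT : J.map (algebraMap S T) = Ideal.span (Set.range fun i => algebraMap S T (x i) ^ (β i + 1)) := by
    rw [Ideal.map_span, ← Set.range_comp]
    congr 2
    ext i; simp
  have hMJ : M ^ (β.degree + 1) ≤ J.map (algebraMap S T) := by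
    rw [hT.map, ← Ideal.map_pow]
    exact Ideal.map_mono (hx.pow_le β)
  have hev : ∀ α, ev x c (monomial α (coeff α p)) = c (coeff α p) * ∏ i, algebraMap S T (x i) ^ α i := by
    intro α
    simp [ev, eval₂_monomial, Finsupp.prod_fintype]
  have h1 : ev x c (monomial β (coeff β p)) ∈ J.map (algebraMap S T) := by
    have hsum : p = ∑ α ∈ p.support, monomial α (coeff α p) := (support_sum_monomial_coeff p).symm
    have h2 : ev x c (monomial β (coeff β p)) = ev x c p - ∑ α ∈ p.support.erase β, ev x c (monomial α (coeff α p)) := by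
      conv_rhs => 
        enter [1]
        rw [hsum, map_sum, ← Finset.add_sum_erase _ _ hβ]
      ring
    rw [h2]
    refine Ideal.sub_mem _ (hMJ (Ideal.pow_le_pow_right (by omega) hp)) (Ideal.sum_mem _ fun α hα => ?_)
    rw [Finset.mem_erase] at hα
    rw [hev, hJT]
    exact Ideal.mul_mem_left _ _ (mono_mem _ β α (hmin α hα.2) hα.1)
  have h2 : algebraMap S T (∏ i, x i ^ β i) ∈ J.map (algebraMap S T) := by
    have hne : coeff β p ≠ 0 := mem_support_iff.mp hβ
    have := Ideal.mul_mem_left _ (c (coeff β p)⁻¹) h1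
    rw [hev, ← mul_assoc, ← map_mul, inv_mul_cancel₀ hne, map_one, one_mul] at this
    simpa using this
  rw [hJT, Ideal.mem_span_range_iff_exists_fun] at h2
  obtain ⟨t, ht⟩ := h2
  choose s hs using fun i => hT.t1 (t i) (β.degree + 1)
  have h3 : algebraMap S T (∏ i, x i ^ β i - ∑ i, s i * x i ^ (β i + 1)) ∈ M ^ (β.degree + 1) := by
    rw [map_sub, ← ht, map_sum, ← Finset.sum_sub_distrib]
    refine Ideal.sum_mem _ fun i _ => ?_
    rw [map_mul, map_pow, ← sub_mul]
    exact Ideal.mul_mem_right _ _ (hs i)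
  have h4 := hx.pow_le β (hT.t2 _ _ h3)
  apply hx.monomial_notMem' β
  have h5 : ∑ i, s i * x i ^ (β i + 1) ∈ Ideal.span (Set.range fun i => x i ^ (β i + 1)) :=
    Ideal.sum_mem _ fun i _ => Ideal.mul_mem_left _ _ (Ideal.subset_span ⟨i, rfl⟩)
  have := Ideal.add_mem _ h4 h5
  simpa using this

end P2b
end LyuV



namespace LyuV

section P2c
open MvPolynomial

/-- Taylor expansion in the variable `i`. -/
noncomputable def tay {n : ℕ} (K : Type) [Field K] (i : Fin n) :
    MvPolynomial (Fin n) K →+* PowerSeries (MvPolynomial (Fin n) K) :=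
  eval₂Hom ((PowerSeries.C).comp C) (fun j => PowerSeries.C (X j) + if i = j then PowerSeries.X else 0)

lemma tay_const {n : ℕ} {K : Type} [Field K] (i : Fin n) (p : MvPolynomial (Fin n) K) :
    PowerSeries.constantCoeff (tay K i p) = p := by
  have : (PowerSeries.constantCoeff).comp (tay K i) = RingHom.id _ := by
    apply MvPolynomial.ringHom_ext
    · intro k; simp [tay]
    · intro j
      by_cases h : i = j <;> simp [tay, h]
  exact DFunLike.congr_fun this p

lemma tay_filt {n : ℕ} {K : Type} [Field K] (i : Fin n) (N : ℕ) : ∀ (p : MvPolynomial (Fin n) K)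
    (_ : p ∈ idealOfVars (Fin n) K ^ N) (s : ℕ),
    PowerSeries.coeff s (tay K i p) ∈ idealOfVars (Fin n) K ^ (N - s) := by
  have hmul : ∀ (N M : ℕ) (f g : PowerSeries (MvPolynomial (Fin n) K)),
      (∀ s, PowerSeries.coeff s f ∈ idealOfVars (Fin n) K ^ (N - s)) →
      (∀ s, PowerSeries.coeff s g ∈ idealOfVars (Fin n) K ^ (M - s)) →
      (∀ s, PowerSeries.coeff s (f * g) ∈ idealOfVars (Fin n) K ^ (N + M - s)) := by
    intro N M f g hf hg s
    rw [PowerSeries.coeff_mul]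
    refine Ideal.sum_mem _ fun uv huv => ?_
    have := Finset.HasAntidiagonal.mem_antidiagonal.mp huv
    have h1 := Ideal.mul_mem_mul (hf uv.1) (hg uv.2)
    rw [← pow_add] at h1
    exact Ideal.pow_le_pow_right (by omega) h1
  have h1 : ∀ p ∈ idealOfVars (Fin n) K, ∀ s, PowerSeries.coeff s (tay K i p) ∈ idealOfVars (Fin n) K ^ (1 - s) := by
    intro p hp s
    rcases s with _ | s
    · rw [PowerSeries.coeff_zero_eq_constantCoeff_apply, tay_const]
      simpa using hp
    · simp
  induction N with
  | zero => intro p _ s; simp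
  | succ N ih =>
    intro p hp
    rw [pow_succ] at hp
    induction hp using Submodule.mul_induction_on' with
    | mem_mul_mem u hu v hv =>
      rw [map_mul]
      exact hmul N 1 _ _ (ih u hu) (h1 v hv)
    | add y _ z _ hy hz =>
      intro s
      rw [map_add, map_add]
      exact Ideal.add_mem _ (hy s) (hz s)

variable {S : Type} [CommRing S] [IsNoetherianRing S] [IsLocalRing S] {n : ℕ} {x : Fin n → S}
  {T : Type} [CommRing T] [Algebra S T] {K : Type} [Field K] {c : K →+* T} {M : Ideal T}

lemma CT.exists_D (hT : CT S T K c M) (hx : RSP S n x) (i : Fin n) (s : ℕ) (z : T) :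
    ∃ w : T, ∀ a p, z - ev x c p ∈ M ^ (a + s) → w - ev x c (PowerSeries.coeff s (tay K i p)) ∈ M ^ a := by
  choose q hq using fun a => hT.approx hx z (a + s)
  have hkey : ∀ a p p', z - ev x c p ∈ M ^ (a + s) → z - ev x c p' ∈ M ^ (a + s) → 
      ev x c (PowerSeries.coeff s (tay K i p)) - ev x c (PowerSeries.coeff s (tay K i p')) ∈ M ^ a := by
    intro a p p' hp hp'
    have h1 : ev x c (p - p') ∈ M ^ (a + s) := by
      have := Ideal.sub_mem _ hp' hp
      rw [map_sub]
      simpa using this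
    have h2 := tay_filt i _ _ (hT.quasi hx _ _ h1) s
    rw [Nat.add_sub_cancel] at h2
    have h3 := hT.ev_idealOfVars hx a _ h2
    rwa [map_sub, map_sub, map_sub] at h3
  obtain ⟨w, hw⟩ := hT.prec (fun a => ev x c (PowerSeries.coeff s (tay K i (q a)))) (fun a =>
    hkey a _ _ (Ideal.pow_le_pow_right (by omega) (hq (a+1))) (hq a))
  refine ⟨w, fun a p hp => ?_⟩
  have := Ideal.add_mem _ (hw a) (hkey a _ _ (hq a) hp)
  simpa using this

lemma CT.exists_HS (hT : CT S T K c M) (hx : RSP S n x) (i : Fin n) :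
    ∃ φ : T →+* PowerSeries T, (∀ z, PowerSeries.constantCoeff (φ z) = z) ∧
      ∀ j, φ (algebraMap S T (x j)) = PowerSeries.C (algebraMap S T (x j)) + if i = j then PowerSeries.X else 0 := by
  choose D hD using hT.exists_D hx i
  have huniq : ∀ (y z : T), (∀ a, y - z ∈ M ^ a) → y = z := fun y z h => sub_eq_zero.mp (hT.haus _ h)
  have hpoly : ∀ s p, D s (ev x c p) = ev x c (PowerSeries.coeff s (tay K i p)) := by
    intro s p
    refine huniq _ _ fun a => hD s _ a p (by simp)
  have hM : ∀ (a b : T) (N s : ℕ), a - b ∈ M ^ (N + s) → a - b ∈ M ^ N := fun a b N s h =>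
    Ideal.pow_le_pow_right (by omega) h
  have hone : ∀ s, D s 1 = PowerSeries.coeff s (1 : PowerSeries T) := by
    intro s
    have := hpoly s 1
    rw [map_one, map_one] at this
    rw [this, PowerSeries.coeff_one, PowerSeries.coeff_one]
    split_ifs <;> simp
  have hadd : ∀ s y z, D s (y + z) = D s y + D s z := by
    intro s y z
    refine huniq _ _ fun a => ?_
    obtain ⟨p, hp⟩ := hT.approx hx y (a + s)
    obtain ⟨q, hq⟩ := hT.approx hx z (a + s)
    have h1 := hD s _ a p hp
    have h2 := hD s _ a q hq
    have h3 := hD s (y + z) a (p + q) (by rw [map_add, add_sub_add_comm]; exact Ideal.add_mem _ hp hq)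
    rw [map_add, map_add, map_add] at h3
    have := Ideal.sub_mem _ h3 (Ideal.add_mem _ h1 h2)
    convert this using 1
    ring
  have hmul : ∀ s y z, D s (y * z) = ∑ uv ∈ Finset.HasAntidiagonal.antidiagonal s, D uv.1 y * D uv.2 z := by
    intro s y z
    refine huniq _ _ fun a => ?_
    obtain ⟨p, hp⟩ := hT.approx hx y (a + s)
    obtain ⟨q, hq⟩ := hT.approx hx z (a + s)
    have hpq : y * z - ev x c (p * q) ∈ M ^ (a + s) := by
      have : y * z - ev x c (p * q) = y * (z - ev x c q) + (y - ev x c p) * ev x c q := by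
        rw [map_mul]; ring
      rw [this]
      exact Ideal.add_mem _ (Ideal.mul_mem_left _ _ hq) (Ideal.mul_mem_right _ _ hp)
    have h3 := hD s (y * z) a (p * q) hpq
    rw [map_mul, PowerSeries.coeff_mul, map_sum] at h3
    have h4 : (∑ uv ∈ Finset.HasAntidiagonal.antidiagonal s, D uv.1 y * D uv.2 z) - 
      ∑ uv ∈ Finset.HasAntidiagonal.antidiagonal s, ev x c (PowerSeries.coeff uv.1 (tay K i p) * PowerSeries.coeff uv.2 (tay K i q)) ∈ M ^ a := by
      rw [← Finset.sum_sub_distrib]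
      refine Ideal.sum_mem _ fun uv huv => ?_
      have := Finset.HasAntidiagonal.mem_antidiagonal.mp huv
      have e1 := hD uv.1 y a p (Ideal.pow_le_pow_right (by omega) hp)
      have e2 := hD uv.2 z a q (Ideal.pow_le_pow_right (by omega) hq)
      rw [map_mul]
      have : ∀ (A B A' B' : T), A * B - A' * B' = A * (B - B') + (A - A') * B' := fun _ _ _ _ => by ring
      rw [this]
      exact Ideal.add_mem _ (Ideal.mul_mem_left _ _ e2) (Ideal.mul_mem_right _ _ e1)
    have := Ideal.sub_mem _ h3 h4
    convert this using 1
    ring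
  let φ : T →+* PowerSeries T := RingHom.mk' 
    ⟨⟨fun z => PowerSeries.mk (fun s => D s z), by
      ext s; simp [hone]⟩, by
      intro y z; ext s
      rw [PowerSeries.coeff_mul]
      simp [hmul]⟩ (by
      intro y z; ext s
      simp [hadd])
  have hφ : ∀ z s, PowerSeries.coeff s (φ z) = D s z := fun z s => by
    change PowerSeries.coeff s (PowerSeries.mk (fun s => D s z)) = _
    rw [PowerSeries.coeff_mk]
  refine ⟨φ, fun z => ?_, fun j => ?_⟩
  · rw [← PowerSeries.coeff_zero_eq_constantCoeff_apply, hφ]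
    refine huniq _ _ fun a => ?_
    obtain ⟨p, hp⟩ := hT.approx hx z a
    have := hD 0 z a p hp
    rw [PowerSeries.coeff_zero_eq_constantCoeff_apply, tay_const] at this
    have := Ideal.sub_mem _ this hp
    simpa using this
  · ext s
    rw [hφ]
    have := hpoly s (X j)
    have h2 : ev x c (X j) = algebraMap S T (x j) := by simp [ev]
    rw [h2] at this
    rw [this]
    have h3 : tay K i (X j) = PowerSeries.C (X j) + if i = j then PowerSeries.X else 0 := by simp [tay]
    rw [h3]
    have h4 : PowerSeries.map (ev (T := T) x c) (PowerSeries.C (X j) + if i = j then PowerSeries.X else 0) = 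
      PowerSeries.C (algebraMap S T (x j)) + if i = j then PowerSeries.X else 0 := by
      rw [← h2]
      split_ifs <;> simp
    rw [← h4, PowerSeries.coeff_map]

lemma CT_adic {S : Type} [CommRing S] [IsNoetherianRing S] [IsLocalRing S]
    (c : ResidueField S →+* AdicCompletion (maximalIdeal S) S)
    (hc : ∀ a, AdicCompletion.evalOneₐ (maximalIdeal S) (c a) = a) :
    CT S (AdicCompletion (maximalIdeal S) S) (ResidueField S) c
      ((maximalIdeal S).map (algebraMap S _)) := by
  have hfg : (maximalIdeal S).FG := IsNoetherian.noetherian _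
  have hker : ∀ (a : ℕ) (z : AdicCompletion (maximalIdeal S) S),
      z ∈ ((maximalIdeal S).map (algebraMap S (AdicCompletion (maximalIdeal S) S))) ^ a ↔
        AdicCompletion.eval (maximalIdeal S) S a z = 0 := by
    intro a z
    rw [← LinearMap.mem_ker, ← AdicCompletion.pow_smul_top_eq_ker_eval hfg, ← Ideal.map_pow,
      Ideal.smul_top_eq_map]
    rfl
  have hof : ∀ s : S, algebraMap S (AdicCompletion (maximalIdeal S) S) s = AdicCompletion.of (maximalIdeal S) S s := by
    intro s; rfl
  have hcomp := AdicCompletion.isAdicComplete_self _ hfg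
  refine ⟨rfl, ?_, ?_, ?_, ?_, ?_⟩
  · intro z a
    obtain ⟨s, hs⟩ := Submodule.Quotient.mk_surjective _ (AdicCompletion.eval (maximalIdeal S) S a z)
    refine ⟨s, (hker _ _).mpr ?_⟩
    rw [map_sub, hof, AdicCompletion.eval_of, ← hs]
    simp
  · intro s a h
    rw [hker, hof, AdicCompletion.eval_of] at h
    have := (Submodule.Quotient.mk_eq_zero _).mp h
    simpa using this
  · intro z hz
    refine hcomp.toIsHausdorff.haus z (fun a => ?_)
    rw [SModEq.zero]
    simpa using hz a
  · intro f hf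
    have hmono : ∀ {a b}, a ≤ b → f b - f a ∈ ((maximalIdeal S).map (algebraMap S (AdicCompletion (maximalIdeal S) S))) ^ a := by
      intro a b hab
      induction b, hab using Nat.le_induction with
      | base => simp
      | succ b hab ih =>
        have := Ideal.add_mem _ (Ideal.pow_le_pow_right hab (hf b)) ih
        simpa using this
    obtain ⟨L, hL⟩ := hcomp.toIsPrecomplete.prec (f := f) (fun {a b} hab => by
      refine SModEq.symm ?_
      rw [SModEq.sub_mem]
      simpa using hmono hab)
    refine ⟨L, fun a => ?_⟩
    have := (hL a).symm
    rw [SModEq.sub_mem] at this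
    simpa using this
  · intro z
    obtain ⟨k, hk⟩ : ∃ k : ResidueField S, k = AdicCompletion.evalOneₐ (maximalIdeal S) z := ⟨_, rfl⟩
    refine ⟨k, ?_⟩
    have h1 : z - c k ∈ RingHom.ker (AdicCompletion.evalOneₐ (maximalIdeal S)) := by
      rw [RingHom.mem_ker, map_sub, sub_eq_zero, hc k]
      exact hk.symm
    have h2 := AdicCompletion.ker_evalOneₐ_eq_map _ hfg
    exact h2.le h1

end P2c
end LyuV



namespace LyuV

section P3
open TensorProduct

variable {S T : Type} [CommRing S] [CommRing T] [Algebra S T]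

/-- Sequences in `M`, with the `T`-action twisted by `φ`. -/
def Tw (φ : T →+* PowerSeries T) (M : Type) : Type := ℕ → M

variable (φ : T →+* PowerSeries T)

noncomputable instance (M : Type) [AddCommGroup M] : AddCommGroup (Tw φ M) :=
  inferInstanceAs (AddCommGroup (ℕ → M))

variable {M M' : Type} [AddCommGroup M] [Module T M] [AddCommGroup M'] [Module T M']

noncomputable instance : SMul T (Tw φ M) where
  smul τ m := fun s => ∑ p ∈ Finset.HasAntidiagonal.antidiagonal s, PowerSeries.coeff p.1 (φ τ) • (m p.2 : M)

lemma Tw.smul_apply (τ : T) (m : Tw φ M) (s : ℕ) : (τ • m) s =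
    ∑ p ∈ Finset.HasAntidiagonal.antidiagonal s, PowerSeries.coeff p.1 (φ τ) • (m p.2 : M) := rfl

lemma Tw.add_apply (a b : Tw φ M) (s : ℕ) : (a + b) s = a s + b s := rfl
lemma Tw.zero_apply (s : ℕ) : (0 : Tw φ M) s = 0 := rfl

noncomputable instance : Module T (Tw φ M) where
  one_smul m := by
    funext s
    rw [Tw.smul_apply, Finset.sum_eq_single (0, s)]
    · simp
    · rintro ⟨a, b⟩ h h'
      have h := Finset.HasAntidiagonal.mem_antidiagonal.1 h
      have : a ≠ 0 := by
        rintro rfl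
        apply h'; simp at h; rw [h]
      simp [PowerSeries.coeff_one, this]
    · intro h
      exact absurd (Finset.HasAntidiagonal.mem_antidiagonal.2 (by simp)) h
  mul_smul x y m := by
    funext s
    simp only [Tw.smul_apply, map_mul, PowerSeries.coeff_mul, Finset.sum_smul, Finset.smul_sum,
      Finset.sum_sigma']
    apply Finset.sum_nbij' (fun ⟨⟨_i, j⟩, ⟨k, l⟩⟩ ↦ ⟨(k, l + j), (l, j)⟩)
      (fun ⟨⟨i, _j⟩, ⟨k, l⟩⟩ ↦ ⟨(i + k, l), (i, k)⟩)
    · rintro ⟨⟨i, j⟩, ⟨k, l⟩⟩ h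
      simp only [Finset.mem_sigma, Finset.HasAntidiagonal.mem_antidiagonal] at h ⊢
      constructor
      · omega
      · trivial
    · rintro ⟨⟨i, j⟩, ⟨k, l⟩⟩ h
      simp only [Finset.mem_sigma, Finset.HasAntidiagonal.mem_antidiagonal] at h ⊢
      constructor
      · omega
      · trivial
    · rintro ⟨⟨i, j⟩, ⟨k, l⟩⟩ h
      simp only [Finset.mem_sigma, Finset.HasAntidiagonal.mem_antidiagonal] at h ⊢
      obtain ⟨h1, rfl⟩ := h; rfl
    · rintro ⟨⟨i, j⟩, ⟨k, l⟩⟩ h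
      simp only [Finset.mem_sigma, Finset.HasAntidiagonal.mem_antidiagonal] at h ⊢
      obtain ⟨h1, rfl⟩ := h; rfl
    · rintro ⟨⟨i, j⟩, ⟨k, l⟩⟩ h
      simp only [mul_smul]
  smul_zero τ := by funext s; simp [Tw.smul_apply, Tw.zero_apply]
  smul_add τ a b := by
    funext s; simp [Tw.smul_apply, Tw.add_apply, Finset.sum_add_distrib]
  add_smul a b m := by
    funext s; simp [Tw.smul_apply, Tw.add_apply, Finset.sum_add_distrib, add_smul]
  zero_smul m := by funext s; simp [Tw.smul_apply, Tw.zero_apply]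

/-- Functoriality of `Tw`. -/
noncomputable def Tw.map (h : M →ₗ[T] M') : Tw φ M →ₗ[T] Tw φ M' where
  toFun m := fun s => h (m s)
  map_add' a b := by funext s; exact map_add h _ _
  map_smul' τ m := by
    funext s
    refine (map_sum h _ _).trans ?_
    exact Finset.sum_congr rfl fun p _ => map_smul h _ _

lemma Tw.map_apply (h : M →ₗ[T] M') (m : Tw φ M) (s : ℕ) : Tw.map φ h m s = h (m s) := rfl

/-- Recursive division by `τ`. -/
noncomputable def Tw.div (u : M → M) (τ : T) (a : Tw φ M) : ℕ → M
  | 0 => u (a 0)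
  | s + 1 => u (a (s+1) - ∑ p ∈ (Finset.HasAntidiagonal.antidiagonal s).attach,
      PowerSeries.coeff (p.1.1 + 1) (φ τ) • Tw.div u τ a p.1.2)
  decreasing_by
    have := Finset.HasAntidiagonal.mem_antidiagonal.1 p.2
    omega

lemma Tw.bij (hφ : ∀ z, PowerSeries.constantCoeff (φ z) = z) (τ : T)
    (h : Function.Bijective (fun m : M => τ • m)) :
    Function.Bijective (fun m : Tw φ M => τ • m) := by
  have key0 : ∀ m : Tw φ M, (τ • m) 0 = τ • m 0 := by
    intro m
    rw [Tw.smul_apply]; simp [hφ]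
  have key : ∀ (m : Tw φ M) s, (τ • m) (s+1) = τ • m (s+1) +
      ∑ p ∈ Finset.HasAntidiagonal.antidiagonal s, PowerSeries.coeff (p.1+1) (φ τ) • (m p.2 : M) := by
    intro m s
    rw [Tw.smul_apply, Finset.Nat.sum_antidiagonal_succ]; simp [hφ]
  constructor
  · rw [show (fun m : Tw φ M => τ • m) = (LinearMap.lsmul T (Tw φ M) τ) from rfl]
    rw [← LinearMap.ker_eq_bot, LinearMap.ker_eq_bot']
    intro m hm
    have hm' : τ • m = 0 := hm
    funext s
    induction s using Nat.strong_induction_on with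
    | _ s ih =>
      apply h.1
      cases s with
      | zero => simp only [← key0, hm', Tw.zero_apply, smul_zero]
      | succ s =>
        have := key m s
        rw [hm', Finset.sum_eq_zero, add_zero] at this
        · simp only [← this, Tw.zero_apply, smul_zero]
        · intro p hp
          have := Finset.HasAntidiagonal.mem_antidiagonal.1 hp
          rw [ih p.2 (by omega), Tw.zero_apply, smul_zero]
  · intro a
    obtain ⟨u, hu⟩ := h.2.hasRightInverse
    refine ⟨Tw.div φ u τ a, ?_⟩
    funext s
    cases s with
    | zero => 
      refine (key0 _).trans ?_
      rw [Tw.div]; exact hu _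
    | succ s =>
      refine (key _ _).trans ?_
      rw [Tw.div]
      have := hu (a (s+1) - ∑ p ∈ (Finset.HasAntidiagonal.antidiagonal s).attach,
        PowerSeries.coeff (p.1.1 + 1) (φ τ) • Tw.div φ u τ a p.1.2)
      simp only at this
      rw [this, Finset.sum_attach (Finset.HasAntidiagonal.antidiagonal s) (fun p => PowerSeries.coeff (p.1 + 1) (φ τ) • Tw.div φ u τ a p.2)]
      abel

/-- Hasse–Schmidt structure. -/
def IsHS (E : M →ₗ[T] Tw φ M) : Prop := ∀ z, E z 0 = z

lemma IsHS.ofInj (E : M →ₗ[T] Tw φ M) (hE : IsHS φ E) (j : M' →ₗ[T] M)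
    (hj : Function.Injective j) (hr : ∀ z s, E (j z) s ∈ LinearMap.range j) :
    ∃ E' : M' →ₗ[T] Tw φ M', IsHS φ E' ∧ ∀ z s, j (E' z s) = E (j z) s := by
  choose e he using hr
  have inj : Function.Injective (Tw.map φ j) := by
    intro a b hab
    funext s
    exact hj (congrFun hab s)
  refine ⟨⟨⟨e, ?_⟩, ?_⟩, ?_, he⟩
  · intro a b
    apply inj
    funext s
    refine (he (a + b) s).trans ?_
    rw [map_add, map_add]
    refine _root_.Eq.trans ?_ (map_add j (e a s) (e b s)).symm
    exact (congrArg₂ (· + ·) (he a s) (he b s)).symm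
  · intro τ a
    apply inj
    rw [RingHom.id_apply, map_smul]
    have : ∀ a, Tw.map φ j (e a) = E (j a) := fun a => funext fun s => he a s
    rw [this, this, map_smul, map_smul]
  · intro z
    exact hj ((he z 0).trans (hE _))

lemma IsHS.ofSurj (E : M →ₗ[T] Tw φ M) (hE : IsHS φ E) (q : M →ₗ[T] M')
    (hq : Function.Surjective q) (hr : ∀ z, q z = 0 → ∀ s, q (E z s) = 0) :
    ∃ E' : M' →ₗ[T] Tw φ M', IsHS φ E' ∧ ∀ z s, E' (q z) s = q (E z s) := by
  have hk : LinearMap.ker q ≤ LinearMap.ker ((Tw.map φ q).comp E) := by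
    intro z hz
    funext s
    exact hr z hz s
  let E' := ((LinearMap.ker q).liftQ _ hk).comp (q.quotKerEquivOfSurjective hq).symm.toLinearMap
  have h : ∀ z s, E' (q z) s = q (E z s) := by
    intro z s
    have : (q.quotKerEquivOfSurjective hq).symm (q z) = Submodule.Quotient.mk z := by
      rw [LinearEquiv.symm_apply_eq]; rfl
    simp only [E', LinearMap.comp_apply, LinearEquiv.coe_coe, this, Submodule.liftQ_apply]
    rfl
  refine ⟨E', ?_, h⟩
  intro z
  obtain ⟨z, rfl⟩ := hq z
  rw [h, hE]

variable {N N' : Type} [AddCommGroup N] [Module S N] [AddCommGroup N'] [Module S N']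

def HH (S : Type) [CommRing S] [Algebra S T] (N : Type) [AddCommGroup N] [Module S N] : Prop := ∃ E : (T ⊗[S] N) →ₗ[T] Tw φ (T ⊗[S] N), IsHS φ E

lemma IsHS.ofLoc (hφ : ∀ z, PowerSeries.constantCoeff (φ z) = z)
    (E : (T ⊗[S] N) →ₗ[T] Tw φ (T ⊗[S] N)) (hE : IsHS φ E) (f : S)
    (l : N →ₗ[S] N') [IsLocalizedModule (Submonoid.powers f) l] :
    ∃ E' : (T ⊗[S] N') →ₗ[T] Tw φ (T ⊗[S] N'), IsHS φ E' ∧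
      ∀ z s, E' (l.baseChange T z) s = l.baseChange T (E z s) := by
  letI : Module S (Tw φ (T ⊗[S] N')) := Module.compHom _ (algebraMap S T)
  haveI : IsScalarTower S T (Tw φ (T ⊗[S] N')) := ⟨fun a b c => by
    rw [Algebra.smul_def, mul_smul]; rfl⟩
  have hbN : Function.Bijective (fun m : N' => f • m) := by
    have := IsLocalizedModule.map_units l (⟨f, Submonoid.mem_powers f⟩ : Submonoid.powers f)
    rw [Module.End.isUnit_iff] at this
    exact this
  have hbT : Function.Bijective (fun m : T ⊗[S] N' => algebraMap S T f • m) := by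
    have := (LinearEquiv.lTensor T (LinearEquiv.ofBijective (LinearMap.lsmul S N' f) hbN)).bijective
    convert this using 1
    funext m
    induction m with
    | zero => simp
    | add a b ha hb => simp only [smul_add, ha, hb, map_add]
    | tmul a b =>
      rw [LinearEquiv.lTensor_tmul, TensorProduct.smul_tmul', smul_eq_mul, ← Algebra.smul_def, TensorProduct.smul_tmul]
      rfl
  have hu : ∀ x : Submonoid.powers f, IsUnit ((algebraMap S (Module.End S (Tw φ (T ⊗[S] N')))) x) := by
    have h1 : IsUnit ((algebraMap S (Module.End S (Tw φ (T ⊗[S] N')))) f) := by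
      rw [Module.End.isUnit_iff]
      exact Tw.bij φ hφ _ hbT
    rintro ⟨_, k, rfl⟩
    simp only [map_pow]
    exact h1.pow k
  let G : (T ⊗[S] N) →ₗ[T] Tw φ (T ⊗[S] N') := (Tw.map φ (l.baseChange T)).comp E
  let g : N →ₗ[S] Tw φ (T ⊗[S] N') := (G.restrictScalars S).comp (TensorProduct.mk S T N 1)
  let g' := IsLocalizedModule.lift (Submonoid.powers f) l g hu
  have hg' : ∀ n, g' (l n) = G (1 ⊗ₜ n) := fun n => IsLocalizedModule.lift_apply (Submonoid.powers f) l g hu n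
  let E' := LinearMap.liftBaseChange T g'
  have h2 : E'.comp (l.baseChange T) = G := by
    apply TensorProduct.AlgebraTensorModule.ext
    intro t n
    simp only [LinearMap.comp_apply, LinearMap.baseChange_tmul, E', LinearMap.liftBaseChange_tmul, hg']
    rw [← map_smul, TensorProduct.smul_tmul', smul_eq_mul, mul_one]
  have h3 : ∀ z s, E' (l.baseChange T z) s = l.baseChange T (E z s) := by
    intro z s
    have := LinearMap.congr_fun h2 z
    exact congrFun this s
  refine ⟨E', ?_, h3⟩
  let ev0 : Tw φ (T ⊗[S] N') →ₗ[T] T ⊗[S] N' := 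
    { toFun := fun m => m 0
      map_add' := fun a b => rfl
      map_smul' := fun τ m => by rw [Tw.smul_apply]; simp [hφ] }
  have h4 : ev0.comp E' = LinearMap.id := by
    apply (LinearMap.liftBaseChangeEquiv T).symm.injective
    have hu' : ∀ x : Submonoid.powers f, IsUnit ((algebraMap S (Module.End S (T ⊗[S] N'))) x) := by
      have h1 : IsUnit ((algebraMap S (Module.End S (T ⊗[S] N'))) f) := by
        rw [Module.End.isUnit_iff]
        convert hbT using 1
        funext m; simp
      rintro ⟨_, k, rfl⟩
      simp only [map_pow]
      exact h1.pow k
    apply IsLocalizedModule.ext (Submonoid.powers f) l hu'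
    ext n
    simp only [LinearMap.comp_apply, LinearMap.liftBaseChangeEquiv_symm_apply, LinearMap.id_apply]
    have := h3 (1 ⊗ₜ n) 0
    rw [hE, LinearMap.baseChange_tmul] at this
    exact this
  exact fun z => LinearMap.congr_fun h4 z

lemma HH.self (hφ : ∀ z, PowerSeries.constantCoeff (φ z) = z) : HH φ S S := by
  let E : T →ₗ[T] Tw φ T :=
    { toFun := fun z s => PowerSeries.coeff s (φ z)
      map_add' := fun a b => by
        funext s
        refine (congrArg _ (map_add φ a b)).trans (map_add _ _ _)
      map_smul' := fun a b => by
        funext s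
        refine (congrArg _ (map_mul φ a b)).trans ?_
        rw [PowerSeries.coeff_mul]
        rfl }
  have hE : IsHS φ E := fun z => (PowerSeries.coeff_zero_eq_constantCoeff_apply _).trans (hφ z)
  obtain ⟨E', h, _⟩ := hE.ofInj φ E (TensorProduct.AlgebraTensorModule.rid S T T).toLinearMap
    (TensorProduct.AlgebraTensorModule.rid S T T).injective (fun z s => by
      rw [LinearMap.range_eq_top.2 (LinearEquiv.surjective _)]; trivial)
  exact ⟨E', h⟩

lemma HH.equiv (e : N ≃ₗ[S] N') (h : HH φ S N) : HH φ S N' := by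
  obtain ⟨E, hE⟩ := h
  obtain ⟨E', h, _⟩ := hE.ofInj φ E (e.symm.baseChange S T N' N).toLinearMap
    (LinearEquiv.injective _) (fun z s => by
      rw [LinearMap.range_eq_top.2 (LinearEquiv.surjective _)]; trivial)
  exact ⟨E', h⟩

lemma HH.ker_coker [Module.Flat S T] (hφ : ∀ z, PowerSeries.constantCoeff (φ z) = z)
    {r : ℕ} (f : Fin r → S) (Nf : Fin r → Type) [∀ i, AddCommGroup (Nf i)] [∀ i, Module S (Nf i)]
    (l : ∀ i, N →ₗ[S] Nf i) [∀ i, IsLocalizedModule (Submonoid.powers (f i)) (l i)]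
    (h : HH φ S N) :
    HH φ S (LinearMap.ker (LinearMap.pi l)) ∧ HH φ S ((∀ i, Nf i) ⧸ LinearMap.range (LinearMap.pi l)) := by
  obtain ⟨E, hE⟩ := h
  choose E' hE' hl using fun i => hE.ofLoc φ hφ E (f i) (l i)
  let Ep : (∀ i, T ⊗[S] Nf i) →ₗ[T] Tw φ (∀ i, T ⊗[S] Nf i) :=
    { toFun := fun m s i => E' i (m i) s
      map_add' := fun a b => by
        funext s i
        exact congrFun (map_add (E' i) (a i) (b i)) s
      map_smul' := fun τ a => by
        funext s i
        refine (congrFun (map_smul (E' i) τ (a i)) s).trans ?_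
        exact (Finset.sum_apply i (Finset.HasAntidiagonal.antidiagonal s) (fun p => PowerSeries.coeff p.1 (φ τ) • (fun i => E' i (a i) p.2))).symm }
  have hEp : IsHS φ Ep := fun z => funext fun i => hE' i (z i)
  let eq := TensorProduct.piRight S T T Nf
  obtain ⟨E2, hE2, heq⟩ := hEp.ofInj φ Ep eq.toLinearMap eq.injective (fun z s => by
      rw [LinearMap.range_eq_top.2 (LinearEquiv.surjective _)]; trivial)
  let g := LinearMap.pi l
  have hg : ∀ z, eq (g.baseChange T z) = fun i => (l i).baseChange T z := by
    intro z
    induction z with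
    | zero => simp; rfl
    | add a b ha hb => rw [map_add, map_add, ha, hb]; funext i; simp
    | tmul a b => 
      funext i
      simp [eq, g]
  have equi : ∀ z s, g.baseChange T (E z s) = E2 (g.baseChange T z) s := by
    intro z s
    apply eq.injective
    rw [hg]
    refine _root_.Eq.trans ?_ (heq _ s).symm
    funext i
    change _ = E' i (eq (g.baseChange T z) i) s
    rw [hg, hl]
  constructor
  · obtain ⟨E1, h1, _⟩ := hE.ofInj φ E ((LinearMap.ker g).subtype.baseChange T)
      (Module.Flat.lTensor_preserves_injective_linearMap _ (Submodule.injective_subtype _)) (by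
      intro z s
      have hex : Function.Exact ((LinearMap.ker g).subtype.lTensor T) (g.lTensor T) :=
        Module.Flat.lTensor_exact T (LinearMap.exact_subtype_ker_map g)
      have h0 : g.baseChange T ((LinearMap.ker g).subtype.baseChange T z) = 0 :=
        (hex _).2 ⟨z, rfl⟩
      have h1 : g.lTensor T (E ((LinearMap.ker g).subtype.baseChange T z) s) = 0 := by
        refine (equi _ s).trans ?_
        rw [h0, map_zero]; rfl
      obtain ⟨w, hw⟩ := (hex _).1 h1
      exact ⟨w, hw⟩)
    exact ⟨E1, h1⟩
  · have hex : Function.Exact (g.lTensor T) ((LinearMap.range g).mkQ.lTensor T) := by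
      apply lTensor_exact T _ (Submodule.mkQ_surjective _)
      exact LinearMap.exact_map_mkQ_range g
    obtain ⟨E1, h1, _⟩ := hE2.ofSurj φ E2 ((LinearMap.range g).mkQ.baseChange T)
      (LinearMap.lTensor_surjective _ (Submodule.mkQ_surjective _)) (by
      intro z hz s
      obtain ⟨w, rfl⟩ := (hex _).1 hz
      have := equi w s
      change (LinearMap.range g).mkQ.baseChange T (E2 (g.baseChange T w) s) = 0
      rw [← this]
      exact (hex _).2 ⟨_, rfl⟩)
    exact ⟨E1, h1⟩

end P3

end LyuV



namespace LyuV

section P4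
open CategoryTheory.Abelian CochainComplex HomComplex Limits

variable {S : Type} [CommRing S]

abbrev NExt (X Y : ModuleCat.{0} S) (k : ℕ) : Type := Abelian.Ext.{0} X Y k
abbrev OExt (X Y : ModuleCat.{0} S) (k : ℕ) : Type := (((_root_.Ext S (ModuleCat.{0} S) k).obj (op X)).obj Y : Type)

variable {X Y : ModuleCat.{0} S} (P : ProjectiveResolution X)

lemma extMk_zero_iff {n : ℕ} (f : P.complex.X n ⟶ Y) (hf : P.complex.d (n+1) n ≫ f = 0) :
    P.extMk f (n+1) rfl hf = 0 ↔ ∃ g, P.complex.d n ((ComplexShape.down ℕ).next n) ≫ g = f := by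
  cases n with
  | succ p =>
    rw [P.extMk_eq_zero_iff f _ _ hf p rfl]
    have : (ComplexShape.down ℕ).next (p+1) = p := by simp
    rw [this]
  | zero =>
    constructor
    · intro h
      refine ⟨0, ?_⟩
      simp only [← P.extEquivCohomologyClass.apply_eq_iff_eq,
        ProjectiveResolution.extEquivCohomologyClass_extMk, ProjectiveResolution.extEquivCohomologyClass_zero,
        CohomologyClass.mk_eq_zero_iff] at h
      rw [Cocycle.toSingleMk_mem_coboundaries_iff _ _ _ _ _ 1 (by simp)] at h
      obtain ⟨g, hg⟩ := h
      have hz : IsZero (P.cochainComplex.X 1) := P.cochainComplex.isZero_of_isStrictlyLE 0 1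
      have : g = 0 := hz.eq_of_src _ _
      rw [this, comp_zero] at hg
      have h2 : f = (P.cochainComplexXIso (-(0:ℕ)) 0 rfl).inv ≫ (P.cochainComplexXIso (-(0:ℕ)) 0 rfl).hom ≫ f := by simp
      rw [h2]
      erw [← hg]
      simp
    · rintro ⟨g, hg⟩
      have : P.complex.d 0 ((ComplexShape.down ℕ).next 0) = 0 := by
        apply P.complex.shape; simp
      rw [this, zero_comp] at hg
      subst hg
      exact P.extMk_zero _ _

lemma smul_extMk {n : ℕ} (r : S) (f : P.complex.X n ⟶ Y) (hf : P.complex.d (n+1) n ≫ f = 0) :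
    r • P.extMk f (n+1) rfl hf = P.extMk (r • f) (n+1) rfl (by simp [hf]) := by
  rw [Abelian.Ext.smul_eq_comp_mk₀, ProjectiveResolution.extMk_comp_mk₀]
  congr 1

/-- The complex computing the old `Ext`. -/
noncomputable abbrev KK (Y : ModuleCat.{0} S) (P : ProjectiveResolution X) : ChainComplex (ModuleCat.{0} S)ᵒᵖ ℕ :=
  (((linearYoneda S (ModuleCat.{0} S)).obj Y).rightOp.mapHomologicalComplex _).obj P.complex

/-- The underlying cochain of an element of the cocycle module. -/
noncomputable def coc (k : ℕ) : ((KK Y P).opcycles k).unop →ₗ[S] (P.complex.X k ⟶ Y) :=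
  ((KK Y P).pOpcycles k).unop.hom

lemma coc_d (k : ℕ) (w) : P.complex.d (k+1) k ≫ coc P k w = (0 : _ ⟶ Y) := by
  have : ((KK Y P).pOpcycles k).unop ≫ ((KK Y P).d (k+1) k).unop = 0 := by
    rw [← unop_comp, (KK Y P).d_pOpcycles]; rfl
  exact congrArg (fun q => q.hom w) this

lemma coc_inj (k : ℕ) : Function.Injective (coc (Y := Y) P k) := by
  have : Mono ((KK Y P).pOpcycles k).unop := inferInstance
  exact (ModuleCat.mono_iff_injective _).1 this

lemma coc_surj (k : ℕ) (f : P.complex.X k ⟶ Y) (hf : P.complex.d (k+1) k ≫ f = 0) :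
    ∃ w, coc P k w = f := by
  let u : ModuleCat.of S S ⟶ ((KK Y P).X k).unop := ModuleCat.ofHom (LinearMap.toSpanSingleton S (P.complex.X k ⟶ Y) f)
  have hu : (KK Y P).d (k+1) k ≫ u.op = 0 := by
    apply Quiver.Hom.unop_inj
    ext
    change P.complex.d (k+1) k ≫ ((1 : S) • f) = 0
    rw [one_smul, hf]
  have h := (KK Y P).p_descOpcycles u.op (k+1) (by simp) hu
  refine ⟨((KK Y P).descOpcycles u.op (k+1) (by simp) hu).unop.hom (1 : S), ?_⟩
  have h' := congrArg (fun q => q.unop.hom (1 : S)) h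
  refine h'.trans ?_
  exact one_smul S f

/-- cocycle to homology -/
noncomputable def hom (k : ℕ) : ((KK Y P).opcycles k).unop →ₗ[S] ((KK Y P).homology k).unop :=
  ((KK Y P).homologyι k).unop.hom

lemma hom_surj (k : ℕ) : Function.Surjective (hom (Y := Y) P k) := by
  have : Epi ((KK Y P).homologyι k).unop := inferInstance
  exact (ModuleCat.epi_iff_surjective _).1 this

lemma hom_zero_iff (k : ℕ) (w) : hom P k w = 0 ↔
    ∃ g : P.complex.X ((ComplexShape.down ℕ).next k) ⟶ Y, P.complex.d k ((ComplexShape.down ℕ).next k) ≫ g = coc P k w := by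
  have hex : (ShortComplex.mk _ _ ((KK Y P).homologyι_comp_fromOpcycles k ((ComplexShape.down ℕ).next k))).Exact :=
    ShortComplex.exact_of_f_is_kernel _ ((KK Y P).homologyIsKernel k _ rfl)
  have hex' := hex.unop
  rw [ShortComplex.moduleCat_exact_iff] at hex'
  have key : ∀ g, coc P k (((KK Y P).fromOpcycles k ((ComplexShape.down ℕ).next k)).unop.hom g) =
      P.complex.d k ((ComplexShape.down ℕ).next k) ≫ (show P.complex.X ((ComplexShape.down ℕ).next k) ⟶ Y from g) := by
    intro g
    have := (KK Y P).p_fromOpcycles k ((ComplexShape.down ℕ).next k)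
    exact congrArg (fun q => q.unop.hom g) this
  constructor
  · intro h
    obtain ⟨g, hg⟩ := hex' w h
    refine ⟨g, ?_⟩
    rw [← key g]
    exact congrArg _ hg
  · rintro ⟨g, hg⟩
    rw [← key g] at hg
    rw [← coc_inj P k hg]
    have := (KK Y P).homologyι_comp_fromOpcycles k ((ComplexShape.down ℕ).next k)
    exact congrArg (fun q => q.unop.hom g) this

/-- cocycle to new Ext -/
noncomputable def cls (k : ℕ) : ((KK Y P).opcycles k).unop →ₗ[S] NExt X Y k where
  toFun w := P.extMk (coc P k w) (k+1) rfl (coc_d P k w)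
  map_add' a b := by
    rw [P.add_extMk]
    congr 1
    exact map_add _ _ _
  map_smul' r a := by
    rw [RingHom.id_apply, smul_extMk]
    congr 1
    exact map_smul _ _ _

lemma cls_surj (k : ℕ) : Function.Surjective (cls (Y := Y) P k) := by
  intro α
  obtain ⟨f, hf, rfl⟩ := P.extMk_surjective α (k+1) rfl
  obtain ⟨w, rfl⟩ := coc_surj P k f hf
  exact ⟨w, rfl⟩

lemma ker_cls (k : ℕ) : LinearMap.ker (cls (Y := Y) P k) = LinearMap.ker (hom P k) := by
  ext w
  rw [LinearMap.mem_ker, LinearMap.mem_ker, hom_zero_iff]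
  exact extMk_zero_iff P (coc P k w) (coc_d P k w)

lemma exists_equiv (k : ℕ) : ∃ e : ((KK Y P).homology k).unop ≃ₗ[S] NExt X Y k,
    ∀ w, e (hom P k w) = cls P k w := by
  let e1 := (hom (Y := Y) P k).quotKerEquivOfSurjective (hom_surj P k)
  let e2 := (cls (Y := Y) P k).quotKerEquivOfSurjective (cls_surj P k)
  refine ⟨(e1.symm.trans (Submodule.quotEquivOfEq _ _ (ker_cls P k).symm)).trans e2, ?_⟩
  intro w
  have : e1.symm (hom P k w) = Submodule.Quotient.mk w := by
    rw [LinearEquiv.symm_apply_eq]; rfl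
  simp only [LinearEquiv.trans_apply, this]
  rfl

noncomputable def homEquiv (k : ℕ) : ((KK Y P).homology k).unop ≃ₗ[S] NExt X Y k := (exists_equiv P k).choose

lemma homEquiv_hom (k : ℕ) (w) : homEquiv P k (hom (Y := Y) P k w) = cls P k w := (exists_equiv P k).choose_spec w

/-- comparison of the two Ext -/
noncomputable def cmp (X Y : ModuleCat.{0} S) (k : ℕ) : OExt X Y k ≃ₗ[S] NExt X Y k :=
  (((projectiveResolution X).isoLeftDerivedObj ((linearYoneda S (ModuleCat.{0} S)).obj Y).rightOp k).unop.symm.toLinearEquiv).trans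
    (homEquiv (projectiveResolution X) k)

lemma cmp_nat {X X' Y : ModuleCat.{0} S} (k : ℕ) (g : X' ⟶ X) (z : OExt X Y k) :
    cmp X' Y k ((((_root_.Ext S (ModuleCat.{0} S) k).map g.op).app Y).hom z) =
    (Abelian.Ext.mk₀ g).comp (cmp X Y k z) (zero_add k) := by
  let P := projectiveResolution X
  let P' := projectiveResolution X'
  let F := ((linearYoneda S (ModuleCat.{0} S)).obj Y).rightOp
  let φ : ProjectiveResolution.Hom P' P g := ⟨ProjectiveResolution.lift g P' P, ProjectiveResolution.lift_commutes_zero g P' P⟩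
  let iX := (P.isoLeftDerivedObj F k)
  let iX' := (P'.isoLeftDerivedObj F k)
  have hnat := ProjectiveResolution.isoLeftDerivedObj_hom_naturality g P' P φ.hom (ProjectiveResolution.lift_commutes_zero g P' P) F k
  obtain ⟨w, hw⟩ := hom_surj (Y := Y) P k (iX.inv.unop.hom z)
  have hz : iX.hom.unop.hom (hom P k w) = z := by
    rw [hw]
    have : iX.inv.unop ≫ iX.hom.unop = 𝟙 _ := by rw [← unop_comp, iX.hom_inv_id]; rfl
    exact congrArg (fun q => q.hom z) this
  subst hz
  let Φ : KK Y P' ⟶ KK Y P := (F.mapHomologicalComplex _).map φ.hom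
  have h1 : cmp X Y k (iX.hom.unop.hom (hom P k w)) = cls P k w := by
    rw [← homEquiv_hom]
    change homEquiv P k (iX.inv.unop.hom (iX.hom.unop.hom (hom P k w))) = _
    rw [← hw]
  have h2 : (((_root_.Ext S (ModuleCat.{0} S) k).map g.op).app Y).hom (iX.hom.unop.hom (hom P k w)) =
      iX'.hom.unop.hom (hom P' k (((HomologicalComplex.opcyclesMap Φ k)).unop.hom w)) := by
    have e1 := congrArg (fun q => q.unop.hom (hom P k w)) hnat
    refine e1.trans ?_
    have e2 := HomologicalComplex.homologyι_naturality Φ k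
    have e3 := congrArg (fun q => q.unop.hom w) e2
    exact congrArg (iX'.hom.unop.hom) e3
  have h3 : ∀ w', cmp X' Y k (iX'.hom.unop.hom (hom P' k w')) = cls P' k w' := by
    intro w'
    rw [← homEquiv_hom]
    have : iX'.hom.unop ≫ iX'.inv.unop = 𝟙 _ := by rw [← unop_comp, iX'.inv_hom_id]; rfl
    exact congrArg (fun q => homEquiv P' k (q.hom (hom P' k w'))) this
  rw [h1, h2, h3]
  refine Eq.trans ?_ (ProjectiveResolution.mk₀_comp_extMk (coc P k w) (k+1) rfl (coc_d P k w) φ).symm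
  have h4 : coc P' k (((HomologicalComplex.opcyclesMap Φ k)).unop.hom w) = φ.hom.f k ≫ coc P k w := by
    have := HomologicalComplex.p_opcyclesMap Φ k
    exact congrArg (fun q => q.unop.hom w) this
  have aux : ∀ (f f' : P'.complex.X k ⟶ Y) hf hf', f = f' → P'.extMk f (k+1) rfl hf = P'.extMk f' (k+1) rfl hf' := by
    rintro f _ hf hf' rfl; rfl
  exact aux _ _ (coc_d P' k _) _ h4

end P4
end LyuV



namespace LyuV

section P5a
open CategoryTheory.Abelian Limits

variable {S : Type} [CommRing S]

/-- Ext of unbundled modules. -/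
abbrev E (A B : Type) [AddCommGroup A] [Module S A] [AddCommGroup B] [Module S B] (k : ℕ) : Type :=
  Abelian.Ext.{0} (ModuleCat.of S A) (ModuleCat.of S B) k

variable {A B C X Y : Type} [AddCommGroup A] [Module S A] [AddCommGroup B] [Module S B]
  [AddCommGroup C] [Module S C] [AddCommGroup X] [Module S X] [AddCommGroup Y] [Module S Y]

/-- degree zero class of a linear map -/
noncomputable abbrev mk0 (f : A →ₗ[S] B) : E (S := S) A B 0 := Abelian.Ext.mk₀ (ModuleCat.ofHom f)

/-- short complex from linear maps -/
abbrev sc (f : A →ₗ[S] B) (g : B →ₗ[S] C) (h : Function.Exact f g) : ShortComplex (ModuleCat.{0} S) :=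
  ShortComplex.mk (ModuleCat.ofHom f) (ModuleCat.ofHom g) (by
    ext x; exact h.apply_apply_eq_zero x)

lemma sc_se (f : A →ₗ[S] B) (g : B →ₗ[S] C) (h : Function.Exact f g)
    (hf : Function.Injective f) (hg : Function.Surjective g) : (sc f g h).ShortExact where
  exact := by
    rw [ShortComplex.moduleCat_exact_iff]
    intro x hx
    exact (h x).1 hx
  mono_f := (ModuleCat.mono_iff_injective _).2 hf
  epi_g := (ModuleCat.epi_iff_surjective _).2 hg

variable (I : Ideal S)

/-- projection between quotients by powers -/
abbrev qmap {t t' : ℕ} (h : t ≤ t') : (S ⧸ I ^ t') →ₗ[S] (S ⧸ I ^ t) :=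
  Submodule.mapQ _ _ LinearMap.id (Ideal.pow_le_pow_right h)

/-- transition maps -/
noncomputable def tr (N : Type) [AddCommGroup N] [Module S N] (k : ℕ) (t t' : ℕ) (h : t ≤ t') :
    E (S := S) (S ⧸ I ^ t) N k →ₗ[S] E (S := S) (S ⧸ I ^ t') N k :=
  (mk0 (qmap I h)).precompOfLinear S _ (zero_add k)

lemma tr_apply (N : Type) [AddCommGroup N] [Module S N] (k : ℕ) (t t' : ℕ) (h : t ≤ t') (x) :
    tr I N k t t' h x = (mk0 (qmap I h)).comp x (zero_add k) := rfl

instance (N : Type) [AddCommGroup N] [Module S N] (k : ℕ) :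
    DirectedSystem (fun t : ℕ => E (S := S) (S ⧸ I ^ t) N k) (fun t t' h => tr I N k t t' h) where
  map_self i x := by
    rw [tr_apply]
    have : qmap I (le_refl i) = LinearMap.id := by
      apply Submodule.linearMap_qext; ext; simp
    rw [mk0, this]
    exact Abelian.Ext.mk₀_id_comp x
  map_map i j k hij hjk x := by
    rw [tr_apply, tr_apply, tr_apply, Abelian.Ext.mk₀_comp_mk₀_assoc]
    congr 2
    rw [← ModuleCat.ofHom_comp]
    congr 1
    apply Submodule.linearMap_qext; ext; simp

/-- Local cohomology, as a direct limit of Ext modules. -/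
def LL (N : Type) [AddCommGroup N] [Module S N] (k : ℕ) : Type :=
  Module.DirectLimit (fun t : ℕ => E (S := S) (S ⧸ I ^ t) N k) (tr I N k)

noncomputable instance (N : Type) [AddCommGroup N] [Module S N] (k : ℕ) : AddCommGroup (LL I N k) :=
  inferInstanceAs (AddCommGroup (Module.DirectLimit (fun t : ℕ => E (S := S) (S ⧸ I ^ t) N k) (tr I N k)))
noncomputable instance (N : Type) [AddCommGroup N] [Module S N] (k : ℕ) : Module S (LL I N k) :=
  inferInstanceAs (Module S (Module.DirectLimit (fun t : ℕ => E (S := S) (S ⧸ I ^ t) N k) (tr I N k)))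

noncomputable def LL.of (N : Type) [AddCommGroup N] [Module S N] (k t : ℕ) :
    E (S := S) (S ⧸ I ^ t) N k →ₗ[S] LL I N k :=
  Module.DirectLimit.of S ℕ _ (tr I N k) t

lemma LL.exists_of {N : Type} [AddCommGroup N] [Module S N] {k : ℕ} (z : LL I N k) :
    ∃ t x, LL.of I N k t x = z := Module.DirectLimit.exists_of (f := tr I N k) z

lemma LL.of_tr {N : Type} [AddCommGroup N] [Module S N] {k : ℕ} {t t' : ℕ} (h : t ≤ t') (x) :
    LL.of I N k t' (tr I N k t t' h x) = LL.of I N k t x := Module.DirectLimit.of_f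

lemma LL.of_zero {N : Type} [AddCommGroup N] [Module S N] {k : ℕ} {t : ℕ} (x)
    (hx : LL.of I N k t x = 0) : ∃ t', ∃ h : t ≤ t', tr I N k t t' h x = 0 :=
  Module.DirectLimit.of.zero_exact (f := tr I N k) hx

lemma LL.subsing (N : Type) [AddCommGroup N] [Module S N] (k : ℕ)
    (h : ∀ t (x : E (S := S) (S ⧸ I ^ t) N k), ∃ t', ∃ h : t ≤ t', tr I N k t t' h x = 0) :
    Subsingleton (LL I N k) := by
  refine ⟨fun a b => ?_⟩
  have : ∀ a : LL I N k, a = 0 := by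
    intro a
    obtain ⟨t, x, rfl⟩ := LL.exists_of I a
    obtain ⟨t', h, hx⟩ := h t x
    rw [← LL.of_tr I h, hx, map_zero]
  rw [this a, this b]

variable {N N' : Type} [AddCommGroup N] [Module S N] [AddCommGroup N'] [Module S N']

lemma tr_comp {m k k' : ℕ} (β : E (S := S) N N' m) (h : k + m = k') {t t' : ℕ} (ht : t ≤ t')
    (x : E (S := S) (S ⧸ I ^ t) N k) :
    tr I N' k' t t' ht (x.comp β h) = (tr I N k t t' ht x).comp β h := by
  rw [tr_apply, tr_apply, Abelian.Ext.comp_assoc _ _ _ (zero_add k) h (by omega)]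

noncomputable def LL.post {m k k' : ℕ} (β : E (S := S) N N' m) (h : k + m = k') :
    LL I N k →ₗ[S] LL I N' k' :=
  Module.DirectLimit.map (f := tr I N k) (f' := tr I N' k') (fun t => β.postcompOfLinear S _ h) (by
    intro t t' ht
    ext x
    exact (tr_comp I β h ht x).symm)

lemma LL.post_of {m k k' : ℕ} (β : E (S := S) N N' m) (h : k + m = k') (t) (x) :
    LL.post I β h (LL.of I N k t x) = LL.of I N' k' t (x.comp β h) :=
  Module.DirectLimit.map_apply_of (f := tr I N k) (f' := tr I N' k') _ _ x

lemma LL.post_exact {N'' : Type} [AddCommGroup N''] [Module S N''] {m k k' : ℕ} (β : E (S := S) N N' m) (h : k + m = k')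
    {m' k'' : ℕ} (β' : E (S := S) N' N'' m') (h' : k' + m' = k'')
    (hz : ∀ {X : ModuleCat.{0} S} (x : Abelian.Ext.{0} X (ModuleCat.of S N) k), (x.comp β h).comp β' h' = 0)
    (hex : ∀ {X : ModuleCat.{0} S} (x : Abelian.Ext.{0} X (ModuleCat.of S N') k'), x.comp β' h' = 0 → ∃ y : Abelian.Ext.{0} X (ModuleCat.of S N) k, y.comp β h = x) :
    Function.Exact (LL.post I β h) (LL.post I β' h') := by
  intro z
  constructor
  · intro hzz
    obtain ⟨t, x, rfl⟩ := LL.exists_of I z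
    rw [LL.post_of] at hzz
    obtain ⟨t', ht, hx⟩ := LL.of_zero I _ hzz
    rw [tr_comp] at hx
    obtain ⟨y, hy⟩ := hex _ hx
    refine ⟨LL.of I N k t' y, ?_⟩
    rw [LL.post_of, hy, LL.of_tr]
  · rintro ⟨z, rfl⟩
    obtain ⟨t, x, rfl⟩ := LL.exists_of I z
    rw [LL.post_of, LL.post_of, hz, map_zero]

section ses
variable (f : A →ₗ[S] B) (g : B →ₗ[S] C) (h : Function.Exact f g)
    (hf : Function.Injective f) (hg : Function.Surjective g)

lemma LL.ex2 (f : A →ₗ[S] B) (g : B →ₗ[S] C) (h : Function.Exact f g)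
    (hf : Function.Injective f) (hg : Function.Surjective g) (k : ℕ) : Function.Exact (LL.post I (k := k) (mk0 f) (add_zero k)) (LL.post I (mk0 g) (add_zero k)) := by
  have hse := sc_se f g h hf hg
  apply LL.post_exact
  · intro X x
    have := hse
    rw [Abelian.Ext.comp_assoc_of_second_deg_zero]
    have e : (mk0 f).comp (mk0 g) (add_zero 0) = 0 := ShortComplex.ext_mk₀_f_comp_ext_mk₀_g (sc f g h)
    rw [e, Abelian.Ext.comp_zero]
  · intro X x hx
    exact Abelian.Ext.covariant_sequence_exact₂ _ hse x hx

lemma LL.ex3 (k k' : ℕ) (hk : k + 1 = k') : Function.Exact (LL.post I (k := k) (mk0 g) (add_zero k)) 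
    (LL.post I (sc_se f g h hf hg).extClass hk) := by
  have hse := sc_se f g h hf hg
  apply LL.post_exact
  · intro X x
    rw [Abelian.Ext.comp_assoc_of_second_deg_zero]
    have e : (mk0 g).comp hse.extClass (zero_add 1) = 0 := hse.comp_extClass
    rw [e, Abelian.Ext.comp_zero]
  · intro X x hx
    exact Abelian.Ext.covariant_sequence_exact₃ _ hse x _ hx

lemma LL.ex1 (k k' : ℕ) (hk : k + 1 = k') : Function.Exact (LL.post I (sc_se f g h hf hg).extClass hk) 
    (LL.post I (mk0 f) (add_zero k')) := by
  have hse := sc_se f g h hf hg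
  apply LL.post_exact
  · intro X x
    rw [Abelian.Ext.comp_assoc_of_third_deg_zero]
    have e : hse.extClass.comp (mk0 f) (add_zero 1) = 0 := hse.extClass_comp
    rw [e, Abelian.Ext.comp_zero]
  · intro X x hx
    exact Abelian.Ext.covariant_sequence_exact₁ _ hse x hx _

end ses

lemma LL.equivLC_aux (k : ℕ) (N : ModuleCat.{0} S) :
    Nonempty (LL I N k ≃ₗ[S] ((localCohomology I k).obj N : Type)) := by
  let D := localCohomology.diagram (localCohomology.idealPowersDiagram I) k
  have : HasColimit D := localCohomology.hasColimitDiagram _ _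
  let cc := ((evaluation _ _).obj N).mapCocone (colimit.cocone D)
  have hc : IsColimit cc := isColimitOfPreserves ((evaluation _ _).obj N) (colimit.isColimit D)
  have hpt : cc.pt = (localCohomology I k).obj N := rfl
  let ι (t : ℕ) : OExt (ModuleCat.of S (S ⧸ I ^ t)) N k →ₗ[S] cc.pt := (cc.ι.app (op (op t))).hom
  have hι : ∀ (t t' : ℕ) (h : t ≤ t') (z), ι t' (((((_root_.Ext S (ModuleCat.{0} S) k).map (ModuleCat.ofHom (qmap I h)).op).app N)).hom z) = ι t z := by
    intro t t' h z
    have := cc.w (show (op (op t) : ℕᵒᵖᵒᵖ) ⟶ op (op t') from (homOfLE h).op.op)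
    exact congrArg (fun q => q.hom z) this
  have key : ∀ (t t' : ℕ) (h : t ≤ t') (z : E (S := S) (S ⧸ I ^ t) N k),
      (cmp (ModuleCat.of S (S ⧸ I ^ t')) N k).symm (tr I N k t t' h z) =
        (((((_root_.Ext S (ModuleCat.{0} S) k).map (ModuleCat.ofHom (qmap I h)).op).app N)).hom ((cmp (ModuleCat.of S (S ⧸ I ^ t)) N k).symm z)) := by
    intro t t' h z
    rw [LinearEquiv.symm_apply_eq, cmp_nat, LinearEquiv.apply_symm_apply]
    rfl
  let F : LL I N k →ₗ[S] cc.pt := Module.DirectLimit.lift S ℕ _ (tr I N k)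
    (fun t => (ι t).comp (cmp (ModuleCat.of S (S ⧸ I ^ t)) N k).symm.toLinearMap) (by
      intro t t' h z
      simp only [LinearMap.comp_apply, LinearEquiv.coe_coe]
      rw [key]
      exact hι t t' h _)
  have hF : ∀ t x, F (LL.of I N k t x) = ι t ((cmp (ModuleCat.of S (S ⧸ I ^ t)) N k).symm x) :=
    fun t x => Module.DirectLimit.lift_of _ _ _
  let dd : Cocone (D ⋙ (evaluation _ _).obj N) := 
    { pt := ModuleCat.of S (LL I N k)
      ι := 
      { app := fun t => ModuleCat.ofHom ((LL.of I N k t.unop.unop).comp (cmp (ModuleCat.of S (S ⧸ I ^ t.unop.unop)) N k).toLinearMap)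
        naturality := by
          intro t t' w
          ext z
          have h : t.unop.unop ≤ t'.unop.unop := leOfHom w.unop.unop
          have h2 := LL.of_tr I (N := N) h (cmp (ModuleCat.of S (S ⧸ I ^ t.unop.unop)) N k z)
          refine Eq.trans ?_ h2
          refine congrArg (LL.of I N k t'.unop.unop) ?_
          exact cmp_nat k (ModuleCat.ofHom (qmap I h)) z } }
  let G : cc.pt →ₗ[S] LL I N k := (hc.desc dd).hom
  have hG : ∀ t z, G (ι t z) = LL.of I N k t (cmp (ModuleCat.of S (S ⧸ I ^ t)) N k z) := by
    intro t z
    have := hc.fac dd (op (op t))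
    exact congrArg (fun q => q.hom z) this
  refine ⟨LinearEquiv.ofLinear F G ?_ ?_⟩
  · have : ModuleCat.ofHom (F.comp G) = 𝟙 cc.pt := by
      apply hc.hom_ext
      intro t
      ext z
      change F (G (ι t.unop.unop z)) = ι t.unop.unop z
      exact (congrArg F (hG t.unop.unop z)).trans ((hF _ _).trans (congrArg (ι t.unop.unop) (LinearEquiv.symm_apply_apply _ _)))
    exact congrArg (fun q => q.hom) this
  · ext z
    obtain ⟨t, x, rfl⟩ := LL.exists_of I z
    change G (F (LL.of I N k t x)) = LL.of I N k t x
    rw [hF, hG, LinearEquiv.apply_symm_apply]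

end P5a
end LyuV



namespace LyuV

section P5b
open CategoryTheory.Abelian Limits

variable {S : Type} [CommRing S]
variable {A B C X Y : Type} [AddCommGroup A] [Module S A] [AddCommGroup B] [Module S B]
  [AddCommGroup C] [Module S C] [AddCommGroup X] [Module S X] [AddCommGroup Y] [Module S Y]

lemma smul_eq_post {k : ℕ} (s : S) (x : E (S := S) A B k) :
    s • x = x.comp (mk0 (s • LinearMap.id : B →ₗ[S] B)) (add_zero k) := by
  rw [Abelian.Ext.smul_eq_comp_mk₀]; rfl

lemma smul_eq_pre {k : ℕ} (s : S) (x : E (S := S) A B k) :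
    s • x = (mk0 (s • LinearMap.id : A →ₗ[S] A)).comp x (zero_add k) := by
  have : mk0 (s • LinearMap.id : A →ₗ[S] A) = s • mk0 (LinearMap.id : A →ₗ[S] A) := by
    rw [smul_eq_post]
    rw [Abelian.Ext.mk₀_comp_mk₀]
    rfl
  rw [this, Abelian.Ext.smul_comp]
  congr 1
  exact (Abelian.Ext.mk₀_id_comp x).symm

lemma mk0_comp_mk0 (f : A →ₗ[S] B) (g : B →ₗ[S] C) :
    (mk0 f).comp (mk0 g) (add_zero 0) = mk0 (g ∘ₗ f) := by
  rw [Abelian.Ext.mk₀_comp_mk₀]; rfl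

lemma mk0_zero : mk0 (0 : A →ₗ[S] B) = 0 := Abelian.Ext.mk₀_zero _ _

lemma pre_pre {k : ℕ} (f : A →ₗ[S] B) (g : B →ₗ[S] C) (x : E (S := S) C X k) :
    (mk0 f).comp ((mk0 g).comp x (zero_add k)) (zero_add k) = (mk0 (g ∘ₗ f)).comp x (zero_add k) := by
  rw [Abelian.Ext.mk₀_comp_mk₀_assoc]; rfl

lemma pre_factor {k : ℕ} (f : A →ₗ[S] B) (g : B →ₗ[S] C) (h : A →ₗ[S] C) (e : h = g ∘ₗ f) (x : E (S := S) C X k)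
    (hx : (mk0 g).comp x (zero_add k) = 0) : (mk0 h).comp x (zero_add k) = 0 := by
  rw [e, ← pre_pre, hx, Abelian.Ext.comp_zero]

lemma post_post {k : ℕ} (f : A →ₗ[S] B) (g : B →ₗ[S] C) (x : E (S := S) X A k) :
    (x.comp (mk0 f) (add_zero k)).comp (mk0 g) (add_zero k) = x.comp (mk0 (g ∘ₗ f)) (add_zero k) := by
  rw [Abelian.Ext.comp_assoc_of_second_deg_zero, mk0_comp_mk0]

lemma E_zero_of_kill {k : ℕ} (s : S) (hX : ∀ a : A, s • a = 0)
    (hB : Function.Bijective (fun b : B => s • b)) (x : E (S := S) A B k) : x = 0 := by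
  have h0 : s • x = 0 := by
    rw [smul_eq_pre]
    have : (s • LinearMap.id : A →ₗ[S] A) = 0 := by ext a; exact hX a
    rw [this, mk0_zero, Abelian.Ext.zero_comp]
  let e : B ≃ₗ[S] B := LinearEquiv.ofBijective (s • LinearMap.id) hB
  have h1 : x.comp (mk0 (LinearMap.id : B →ₗ[S] B)) (add_zero k) = x := Abelian.Ext.comp_mk₀_id x
  rw [← h1]
  have : (LinearMap.id : B →ₗ[S] B) = e.symm.toLinearMap ∘ₗ (s • LinearMap.id) := by
    ext b
    exact (e.symm_apply_apply b).symm
  rw [this, ← post_post, ← smul_eq_post, h0, Abelian.Ext.zero_comp]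

lemma E_zero_pi {k r : ℕ} (Bf : Fin r → Type) [∀ i, AddCommGroup (Bf i)] [∀ i, Module S (Bf i)]
    (h : ∀ i (x : E (S := S) A (Bf i) k), x = 0) (x : E (S := S) A (∀ i, Bf i) k) : x = 0 := by
  have h1 : x.comp (mk0 (LinearMap.id : (∀ i, Bf i) →ₗ[S] _)) (add_zero k) = x := Abelian.Ext.comp_mk₀_id x
  have hs : ∀ T : Finset (Fin r), x.comp (mk0 (∑ i ∈ T, (LinearMap.single S Bf i) ∘ₗ (LinearMap.proj i))) (add_zero k) = 0 := by
    intro T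
    induction T using Finset.induction_on with
    | empty => rw [Finset.sum_empty, mk0_zero, Abelian.Ext.comp_zero]
    | insert a T ha ih =>
      rw [Finset.sum_insert ha]
      have : mk0 ((LinearMap.single S Bf a) ∘ₗ (LinearMap.proj a) + ∑ i ∈ T, (LinearMap.single S Bf i) ∘ₗ (LinearMap.proj i)) = mk0 ((LinearMap.single S Bf a) ∘ₗ (LinearMap.proj a)) + mk0 (∑ i ∈ T, (LinearMap.single S Bf i) ∘ₗ (LinearMap.proj i)) := by
        rw [mk0, ModuleCat.ofHom_add, Abelian.Ext.mk₀_add]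
      rw [this, Abelian.Ext.comp_add, ih, add_zero, ← post_post, h a (x.comp (mk0 (LinearMap.proj a)) (add_zero k)), Abelian.Ext.zero_comp]
  have h2 : (LinearMap.id : (∀ i, Bf i) →ₗ[S] _) = ∑ i ∈ Finset.univ, (LinearMap.single S Bf i) ∘ₗ (LinearMap.proj i) := by
    ext i b j
    simp [Finset.sum_apply, Pi.single_apply]
  rw [← h1, h2, hs]

variable (I : Ideal S)

lemma bij_pow {f : S} (hB : Function.Bijective (fun b : B => f • b)) (t : ℕ) :
    Function.Bijective (fun b : B => f ^ t • b) := by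
  induction t with
  | zero => 
    have : (fun b : B => f ^ 0 • b) = id := by ext b; simp
    rw [this]; exact Function.bijective_id
  | succ t ih =>
    have : (fun b : B => f ^ (t+1) • b) = (fun b => f ^ t • b) ∘ (fun b => f • b) := by
      ext b; simp [pow_succ, mul_smul]
    rw [this]
    exact ih.comp hB

lemma LL_zero_of_loc {f : S} (hf : f ∈ I) (hB : Function.Bijective (fun b : B => f • b)) (k : ℕ) :
    Subsingleton (LL I B k) := by
  apply LL.subsing
  intro t x
  refine ⟨t, le_refl t, ?_⟩
  rw [E_zero_of_kill (f ^ t) ?_ ?_ x, map_zero]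
  · intro a
    obtain ⟨a, rfl⟩ := Submodule.Quotient.mk_surjective _ a
    rw [← Submodule.Quotient.mk_smul, Submodule.Quotient.mk_eq_zero]
    exact Ideal.mul_mem_right _ _ (Ideal.pow_mem_pow hf t)
  · exact bij_pow hB t

lemma LL_zero_of_pi {r : ℕ} (f : Fin r → S) (hf : ∀ i, f i ∈ I) (Bf : Fin r → Type) [∀ i, AddCommGroup (Bf i)] [∀ i, Module S (Bf i)]
    (hB : ∀ i, Function.Bijective (fun b : Bf i => f i • b)) (k : ℕ) :
    Subsingleton (LL I (∀ i, Bf i) k) := by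
  apply LL.subsing
  intro t x
  refine ⟨t, le_refl t, ?_⟩
  rw [E_zero_pi Bf ?_ x, map_zero]
  intro i x
  refine E_zero_of_kill (f i ^ t) ?_ ?_ x
  · intro a
    obtain ⟨a, rfl⟩ := Submodule.Quotient.mk_surjective _ a
    rw [← Submodule.Quotient.mk_smul, Submodule.Quotient.mk_eq_zero]
    exact Ideal.mul_mem_right _ _ (Ideal.pow_mem_pow (hf i) t)
  · exact bij_pow (hB i) t

/-- torsion -/
def Tors (N : Type) [AddCommGroup N] [Module S N] : Prop := ∀ m : N, ∃ t : ℕ, ∀ a ∈ I ^ t, a • m = 0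

section kill
variable {A' B' C' : Type} [AddCommGroup A'] [Module S A'] [AddCommGroup B'] [Module S B']
  [AddCommGroup C'] [Module S C']

lemma ses_kill (f : A →ₗ[S] B) (g : B →ₗ[S] C) (h : Function.Exact f g)
    (hf : Function.Injective f) (hg : Function.Surjective g)
    (f' : A' →ₗ[S] B') (g' : B' →ₗ[S] C') (h' : Function.Exact f' g')
    (hf' : Function.Injective f') (hg' : Function.Surjective g')
    (a : A →ₗ[S] A') (b : B →ₗ[S] B') (c : C →ₗ[S] C') (h1 : f' ∘ₗ a = b ∘ₗ f) (h2 : g' ∘ₗ b = c ∘ₗ g)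
    {k k' : ℕ} (hk : 1 + k = k') (y : E (S := S) A' X k) (hy : (mk0 a).comp y (zero_add k) = 0) :
    (mk0 c).comp ((sc_se f' g' h' hf' hg').extClass.comp y hk) (zero_add k') = 0 := by
  let φ : sc f g h ⟶ sc f' g' h' := 
    { τ₁ := ModuleCat.ofHom a, τ₂ := ModuleCat.ofHom b, τ₃ := ModuleCat.ofHom c
      comm₁₂ := by
        have := congrArg ModuleCat.ofHom h1
        exact this
      comm₂₃ := by
        have := congrArg ModuleCat.ofHom h2
        exact this }
  have := ShortComplex.ShortExact.extClass_naturality (sc_se f g h hf hg) (sc_se f' g' h' hf' hg') φ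
  have e : (sc_se f g h hf hg).extClass.comp (mk0 a) (add_zero 1) = (mk0 c).comp (sc_se f' g' h' hf' hg').extClass (zero_add 1) := this
  rw [← Abelian.Ext.comp_assoc (mk0 c) _ y (zero_add 1) hk (by omega), ← e, Abelian.Ext.comp_assoc_of_second_deg_zero, hy, Abelian.Ext.comp_zero]

lemma exists_lift (f : A →ₗ[S] B) (g : B →ₗ[S] C) (h : Function.Exact f g)
    (hf : Function.Injective f) (hg : Function.Surjective g) [Module.Projective S B] {k : ℕ} (x : E (S := S) C X (k+1)) :
    ∃ y : E (S := S) A X k, (sc_se f g h hf hg).extClass.comp y (add_comm 1 k) = x := by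
  have hse := sc_se f g h hf hg
  have : Projective (ModuleCat.of S B) := (IsProjective.iff_projective B).1 inferInstance
  refine Abelian.Ext.contravariant_sequence_exact₃ hse _ x ?_ _
  exact Abelian.Ext.eq_zero_of_projective _
end kill

variable {I} in
lemma Tors.fg {N : Type} [AddCommGroup N] [Module S N] (h : Tors I N) [Module.Finite S A] (φ : A →ₗ[S] N) :
    ∃ t, ∀ a ∈ I ^ t, ∀ m, a • φ m = 0 := by
  obtain ⟨T, hT⟩ := (Module.Finite.fg_top : (⊤ : Submodule S A).FG)
  choose g hg using h
  refine ⟨T.sup (fun m => g (φ m)), fun a ha m => ?_⟩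
  have hm : m ∈ Submodule.span S (T : Set A) := by rw [hT]; trivial
  induction hm using Submodule.span_induction with
  | mem x hx => 
    exact hg _ a (Ideal.pow_le_pow_right (Finset.le_sup (f := fun m => g (φ m)) hx) ha)
  | zero => simp
  | add x y _ _ hx hy => rw [map_add, smul_add, hx, hy, add_zero]
  | smul c x _ hx => rw [map_smul, smul_comm, hx, smul_zero]

lemma tors_restrict [IsNoetherianRing S] {N : Type} [AddCommGroup N] [Module S N] (h : Tors I N) (k : ℕ) :
    ∀ (X : Type) [AddCommGroup X] [Module S X] [Module.Finite S X] (x : E (S := S) X N k),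
      ∃ t, (mk0 (I ^ t • (⊤ : Submodule S X)).subtype).comp x (zero_add k) = 0 := by
  induction k with
  | zero =>
    intro X _ _ _ x
    obtain ⟨φ, rfl⟩ : ∃ φ : X →ₗ[S] N, mk0 φ = x := by
      obtain ⟨f, hf⟩ := (Abelian.Ext.mk₀_bijective _ _).2 x
      exact ⟨f.hom, hf⟩
    obtain ⟨t, ht⟩ := h.fg φ
    refine ⟨t, ?_⟩
    rw [mk0_comp_mk0]
    have : φ ∘ₗ (I ^ t • (⊤ : Submodule S X)).subtype = 0 := by
      ext ⟨x, hx⟩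
      change φ x = 0
      induction hx using Submodule.smul_induction_on' with
      | smul r hr n hn => rw [map_smul, ht r hr]
      | add x hx y hy h1 h2 => rw [map_add, h1, h2, add_zero]
    rw [this, mk0_zero]
  | succ k ih =>
    intro X _ _ _ x
    obtain ⟨m, π, hπ⟩ := Module.Finite.exists_fin' S X
    obtain ⟨y, rfl⟩ := exists_lift (LinearMap.ker π).subtype π (LinearMap.exact_subtype_ker_map π) (Subtype.val_injective) hπ x
    obtain ⟨t0, ht0⟩ := ih _ y
    obtain ⟨c, hc⟩ := Ideal.exists_pow_inf_eq_pow_smul I (LinearMap.ker π)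
    refine ⟨t0 + c, ?_⟩
    let B1 : Submodule S (Fin m → S) := I ^ (t0 + c) • ⊤
    let A1 : Submodule S (LinearMap.ker π) := B1.comap (LinearMap.ker π).subtype
    let C1 : Submodule S X := I ^ (t0 + c) • ⊤
    have hBC : C1 = B1.map π := by
      simp only [B1, C1]
      rw [Submodule.map_smul'', Submodule.map_top, LinearMap.range_eq_top.2 hπ]
    let f : A1 →ₗ[S] B1 := (LinearMap.ker π).subtype.restrict (fun x hx => hx)
    let g : B1 →ₗ[S] C1 := π.restrict (fun x hx => by rw [hBC]; exact ⟨x, hx, rfl⟩)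
    have hfi : Function.Injective f := by
      intro a b hab
      apply Subtype.ext; apply Subtype.ext
      have h5 : ((f a : B1) : Fin m → S) = (f b : B1) := by rw [hab]
      exact h5
    have hgs : Function.Surjective g := by
      rintro ⟨c, hcc⟩
      have := hcc
      rw [hBC] at this
      obtain ⟨b, hb, rfl⟩ := this
      exact ⟨⟨b, hb⟩, rfl⟩
    have hex : Function.Exact f g := by
      rintro ⟨b, hb⟩
      constructor
      · intro hgb
        have hgb : π b = 0 := congrArg Subtype.val hgb
        exact ⟨⟨⟨b, hgb⟩, hb⟩, rfl⟩
      · rintro ⟨a, ha⟩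
        have : b = a.1.1 := (congrArg Subtype.val ha).symm
        subst this
        exact Subtype.ext a.1.2
    have e1 : (LinearMap.ker π).subtype ∘ₗ A1.subtype = B1.subtype ∘ₗ f := rfl
    have e2 : π ∘ₗ B1.subtype = C1.subtype ∘ₗ g := rfl
    refine ses_kill (A := A1) (B := B1) (C := C1) (A' := LinearMap.ker π) f g hex hfi hgs (LinearMap.ker π).subtype π (LinearMap.exact_subtype_ker_map π) (Subtype.val_injective) hπ A1.subtype B1.subtype C1.subtype e1 e2 _ y ?_
    have hA : A1 ≤ I ^ t0 • ⊤ := by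
      rintro ⟨a, ha⟩ ha1
      have h1 : a ∈ I ^ (t0 + c) • ⊤ ⊓ LinearMap.ker π := ⟨ha1, ha⟩
      rw [hc _ (by omega), Nat.add_sub_cancel] at h1
      have h2 : a ∈ I ^ t0 • LinearMap.ker π := Submodule.smul_mono le_rfl inf_le_right h1
      have h3 : (I ^ t0 • (⊤ : Submodule S (LinearMap.ker π))).map (LinearMap.ker π).subtype = I ^ t0 • LinearMap.ker π := by
        rw [Submodule.map_smul'', Submodule.map_top, Submodule.range_subtype]
      rw [← h3] at h2
      obtain ⟨b, hb, hba⟩ := h2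
      have : b = ⟨a, ha⟩ := Subtype.ext hba
      rwa [← this]
    have : A1.subtype = (I ^ t0 • ⊤ : Submodule S (LinearMap.ker π)).subtype ∘ₗ Submodule.inclusion hA := rfl
    exact pre_factor _ _ _ this y ht0

lemma LL_zero_of_tors [IsNoetherianRing S] {N : Type} [AddCommGroup N] [Module S N] (h : Tors I N) (k : ℕ) :
    Subsingleton (LL I N (k+1)) := by
  apply LL.subsing
  intro t x
  have hex : ∀ t, Function.Exact (I ^ t).subtype (I ^ t).mkQ := fun t => LinearMap.exact_subtype_mkQ _
  have hi : ∀ t, Function.Injective (I ^ t).subtype := fun t => Subtype.val_injective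
  have hs : ∀ t, Function.Surjective (I ^ t).mkQ := fun t => Submodule.mkQ_surjective _
  obtain ⟨y, rfl⟩ := exists_lift (I ^ t).subtype (I ^ t).mkQ (hex t) (hi t) (hs t) x
  obtain ⟨s, hs'⟩ := tors_restrict I h k _ y
  refine ⟨s + t, by omega, ?_⟩
  rw [tr_apply]
  have hle : I ^ (s + t) ≤ I ^ t := Ideal.pow_le_pow_right (by omega)
  refine ses_kill (I ^ (s+t)).subtype (I ^ (s+t)).mkQ (hex _) (hi _) (hs _) _ _ (hex t) (hi t) (hs t) (Submodule.inclusion hle) LinearMap.id _ rfl rfl _ y ?_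
  have h3 : (I ^ s • (⊤ : Submodule S (I ^ t : Ideal S))).map (I ^ t).subtype = I ^ (s + t) := by
    rw [Submodule.map_smul'', Submodule.map_top, Submodule.range_subtype, pow_add]; rfl
  have hA : ∀ a : (I ^ (s+t) : Ideal S), Submodule.inclusion hle a ∈ I ^ s • (⊤ : Submodule S (I ^ t : Ideal S)) := by
    rintro ⟨a, ha⟩
    rw [← h3] at ha
    obtain ⟨b, hb, hba⟩ := ha
    have : b = Submodule.inclusion hle ⟨a, by rw [← h3]; exact ⟨b, hb, hba⟩⟩ := Subtype.ext hba
    rw [← this]; exact hb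
  have : Submodule.inclusion hle = (I ^ s • ⊤ : Submodule S (I ^ t : Ideal S)).subtype ∘ₗ (LinearMap.codRestrict _ (Submodule.inclusion hle) hA) := rfl
  rw [this, ← pre_pre, hs', Abelian.Ext.comp_zero]

end P5b
end LyuV



namespace LyuV

section P5c
open CategoryTheory.Abelian Limits

variable {S : Type} [CommRing S]
variable {A B C X Y : Type} [AddCommGroup A] [Module S A] [AddCommGroup B] [Module S B]
  [AddCommGroup C] [Module S C] [AddCommGroup X] [Module S X] [AddCommGroup Y] [Module S Y]

/-- the linear map underlying a degree zero class -/
noncomputable def E0 (x : E (S := S) A B 0) : A →ₗ[S] B := (Abelian.Ext.addEquiv₀ x).hom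

lemma mk0_E0 (x : E (S := S) A B 0) : mk0 (E0 x) = x := Abelian.Ext.mk₀_addEquiv₀_apply x

lemma mk0_inj {f g : A →ₗ[S] B} (h : mk0 f = mk0 g) : f = g :=
  congrArg ModuleCat.Hom.hom ((Abelian.Ext.mk₀_bijective _ _).1 h)

lemma E0_mk0 (f : A →ₗ[S] B) : E0 (mk0 f) = f := mk0_inj (mk0_E0 _)

lemma mk0_add (f g : A →ₗ[S] B) : mk0 (f + g) = mk0 f + mk0 g := by
  rw [mk0, ModuleCat.ofHom_add, Abelian.Ext.mk₀_add]

lemma mk0_smul (s : S) (f : A →ₗ[S] B) : mk0 (s • f) = s • mk0 f := by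
  rw [smul_eq_post, mk0_comp_mk0]

variable (I : Ideal S) (N : Type) [AddCommGroup N] [Module S N]

noncomputable def LL.ev0 (t : ℕ) : E (S := S) (S ⧸ I ^ t) N 0 →ₗ[S] N where
  toFun x := E0 x (Submodule.Quotient.mk 1)
  map_add' x y := by
    rw [← mk0_E0 x, ← mk0_E0 y, ← mk0_add, E0_mk0, E0_mk0, E0_mk0]; rfl
  map_smul' s x := by
    rw [← mk0_E0 x, ← mk0_smul, E0_mk0, E0_mk0]; rfl

lemma LL.ev0_mk0 (t : ℕ) (f : (S ⧸ I ^ t) →ₗ[S] N) : LL.ev0 I N t (mk0 f) = f (Submodule.Quotient.mk 1) :=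
  congrArg (fun q : (S ⧸ I ^ t) →ₗ[S] N => q (Submodule.Quotient.mk 1)) (E0_mk0 f)

noncomputable def LL.ev : LL I N 0 →ₗ[S] N :=
  Module.DirectLimit.lift S ℕ _ (tr I N 0) (fun t => LL.ev0 I N t) (by
    intro t t' h x
    rw [← mk0_E0 x, tr_apply, mk0_comp_mk0, LL.ev0_mk0, LL.ev0_mk0]
    rfl)

lemma LL.ev_of (t : ℕ) (x) : LL.ev I N (LL.of I N 0 t x) = LL.ev0 I N t x :=
  Module.DirectLimit.lift_of _ _ _

lemma LL.ev_inj : Function.Injective (LL.ev I N) := by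
  rw [injective_iff_map_eq_zero]
  intro z hz
  obtain ⟨t, x, rfl⟩ := LL.exists_of I z
  rw [LL.ev_of, ← mk0_E0 x, LL.ev0_mk0] at hz
  have : E0 x = 0 := by
    apply Submodule.linearMap_qext
    ext
    exact hz
  rw [← mk0_E0 x, this, mk0_zero, map_zero]

lemma LL.mem_range_ev (m : N) : m ∈ LinearMap.range (LL.ev I N) ↔ ∃ t : ℕ, ∀ a ∈ I ^ t, a • m = 0 := by
  constructor
  · rintro ⟨z, rfl⟩
    obtain ⟨t, x, rfl⟩ := LL.exists_of I z
    refine ⟨t, fun a ha => ?_⟩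
    rw [LL.ev_of, ← mk0_E0 x, LL.ev0_mk0, ← map_smul, ← Submodule.Quotient.mk_smul]
    have : (Submodule.Quotient.mk (a • (1 : S)) : S ⧸ I ^ t) = 0 := by
      rw [Submodule.Quotient.mk_eq_zero]; simpa using ha
    rw [this, map_zero]
  · rintro ⟨t, ht⟩
    let f : (S ⧸ I ^ t) →ₗ[S] N := Submodule.liftQ _ (LinearMap.toSpanSingleton S N m) (by
      intro a ha; exact ht a ha)
    refine ⟨LL.of I N 0 t (mk0 f), ?_⟩
    rw [LL.ev_of, LL.ev0_mk0]
    change (1 : S) • m = m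
    simp

section cech
variable {r : ℕ} (f : Fin r → S)

abbrev Nf (i : Fin r) : Type := LocalizedModule (Submonoid.powers (f i)) N

noncomputable abbrev nl (i : Fin r) : N →ₗ[S] Nf (S := S) N f i := LocalizedModule.mkLinearMap _ _

lemma loc_bij (s : S) {N' : Type} [AddCommGroup N'] [Module S N'] (l : N →ₗ[S] N') [IsLocalizedModule (Submonoid.powers s) l] :
    Function.Bijective (fun b : N' => s • b) := by
  have := IsLocalizedModule.map_units l ⟨s, Submonoid.mem_powers s⟩
  rw [Module.End.isUnit_iff] at this
  exact this

lemma loc_zero (s : S) {N' : Type} [AddCommGroup N'] [Module S N'] (l : N →ₗ[S] N') [IsLocalizedModule (Submonoid.powers s) l]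
    (m : N) : l m = 0 ↔ ∃ t : ℕ, s ^ t • m = 0 := by
  rw [IsLocalizedModule.eq_zero_iff (Submonoid.powers s)]
  constructor
  · rintro ⟨⟨_, t, rfl⟩, h⟩; exact ⟨t, h⟩
  · rintro ⟨t, h⟩; exact ⟨⟨_, t, rfl⟩, h⟩

lemma mem_ker_pi [IsNoetherianRing S] (hI : I = Ideal.span (Set.range f)) (m : N) :
    m ∈ LinearMap.ker (LinearMap.pi (nl N f)) ↔ ∃ t : ℕ, ∀ a ∈ I ^ t, a • m = 0 := by
  rw [LinearMap.mem_ker]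
  constructor
  · intro h
    have h1 : ∀ i, nl N f i m = 0 := fun i => congrFun h i
    have h2 : I ≤ (Ideal.torsionOf S N m).radical := by
      rw [hI, Ideal.span_le]
      rintro _ ⟨i, rfl⟩
      obtain ⟨t, ht⟩ := (loc_zero N (f i) (nl N f i) m).1 (h1 i)
      exact ⟨t, ht⟩
    obtain ⟨t, ht⟩ := Ideal.exists_pow_le_of_le_radical_of_fg h2 (IsNoetherian.noetherian I)
    exact ⟨t, fun a ha => ht ha⟩
  · rintro ⟨t, ht⟩
    funext i
    refine (loc_zero N (f i) (nl N f i) m).2 ⟨t, ht _ (Ideal.pow_mem_pow ?_ t)⟩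
    rw [hI]; exact Ideal.subset_span ⟨i, rfl⟩

lemma bij_post_of (f : A →ₗ[S] B) (g : B →ₗ[S] C) (h : Function.Exact f g)
    (hf : Function.Injective f) (hg : Function.Surjective g) (k k' : ℕ) (hk : k + 1 = k') (h1 : Subsingleton (LL I A k))
     (h2 : Subsingleton (LL I A k')) : Nonempty (LL I B k ≃ₗ[S] LL I C k) := by
  refine ⟨LinearEquiv.ofBijective (LL.post I (k := k) (mk0 g) (add_zero k)) ⟨?_, ?_⟩⟩
  · rw [injective_iff_map_eq_zero]
    intro z hz
    obtain ⟨w, rfl⟩ := (LL.ex2 I f g h hf hg k z).1 hz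
    rw [Subsingleton.elim w 0, map_zero]
  · intro z
    exact (LL.ex3 I f g h hf hg k k' hk z).1 (Subsingleton.elim _ _)

lemma bij_conn_of (f : A →ₗ[S] B) (g : B →ₗ[S] C) (h : Function.Exact f g)
    (hf : Function.Injective f) (hg : Function.Surjective g) (k k' : ℕ) (hk : k + 1 = k') (h1 : Subsingleton (LL I B k))
     (h2 : Subsingleton (LL I B k')) : Nonempty (LL I C k ≃ₗ[S] LL I A k') := by
  refine ⟨LinearEquiv.ofBijective (LL.post I (sc_se f g h hf hg).extClass hk) ⟨?_, ?_⟩⟩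
  · rw [injective_iff_map_eq_zero]
    intro z hz
    obtain ⟨w, rfl⟩ := (LL.ex3 I f g h hf hg k k' hk z).1 hz
    rw [Subsingleton.elim w 0, map_zero]
  · intro z
    exact (LL.ex1 I f g h hf hg k k' hk z).1 (Subsingleton.elim _ _)

lemma exact_range_mkQ (q : A →ₗ[S] B) : Function.Exact (LinearMap.range q).subtype (LinearMap.range q).mkQ :=
  LinearMap.exact_subtype_mkQ _

lemma exact_ker_rangeRestrict (q : A →ₗ[S] B) : Function.Exact (LinearMap.ker q).subtype q.rangeRestrict := by
  intro x
  rw [← LinearMap.mem_ker, LinearMap.ker_rangeRestrict, Submodule.coe_subtype, Subtype.range_coe]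
  rfl

theorem HH_LL [IsNoetherianRing S] (hI : I = Ideal.span (Set.range f)) {T : Type} [CommRing T] [Algebra S T] [Module.Flat S T]
    (φ : T →+* PowerSeries T) (hφ : ∀ z, PowerSeries.constantCoeff (φ z) = z) (k : ℕ) :
    ∀ (N : Type) [AddCommGroup N] [Module S N], HH φ S N → HH φ S (LL I N k) := by
  induction k with
  | zero =>
    intro N _ _ h
    have h1 := (HH.ker_coker φ hφ f (Nf N f) (nl N f) h).1
    have e : LinearMap.range (LL.ev I N) = LinearMap.ker (LinearMap.pi (nl N f)) := by
      ext m
      rw [LL.mem_range_ev, mem_ker_pi I N f hI]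
    rw [← e] at h1
    exact HH.equiv φ (LinearEquiv.ofInjective _ (LL.ev_inj I N)).symm h1
  | succ k ih =>
    intro N _ _ h
    have h1 := (HH.ker_coker φ hφ f (Nf N f) (nl N f) h).2
    have h2 := ih _ h1
    have hfI : ∀ i, f i ∈ I := fun i => by rw [hI]; exact Ideal.subset_span ⟨i, rfl⟩
    have hz := LL_zero_of_pi I f hfI (Nf N f) (fun i => loc_bij N (f i) (nl N f i))
    have ht : Tors I (LinearMap.ker (LinearMap.pi (nl N f))) := by
      rintro ⟨m, hm⟩
      obtain ⟨t, ht⟩ := (mem_ker_pi I N f hI m).1 hm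
      exact ⟨t, fun a ha => Subtype.ext (ht a ha)⟩
    obtain ⟨e1⟩ := bij_conn_of I _ _ (exact_range_mkQ (LinearMap.pi (nl N f))) Subtype.val_injective (Submodule.mkQ_surjective _) k (k+1) rfl (hz k) (hz (k+1))
    obtain ⟨e2⟩ := bij_post_of I _ _ (exact_ker_rangeRestrict (LinearMap.pi (nl N f))) Subtype.val_injective (LinearMap.surjective_rangeRestrict _) (k+1) (k+2) rfl (LL_zero_of_tors I ht k) (LL_zero_of_tors I ht (k+1))
    exact HH.equiv φ (e1.trans e2.symm) h2

end cech
end P5c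
end LyuV



namespace LyuV

section P6
open CategoryTheory.Abelian Limits

variable {S : Type} [CommRing S]
variable {A B C : Type} [AddCommGroup A] [Module S A] [AddCommGroup B] [Module S B]
  [AddCommGroup C] [Module S C] 

/-- `dim N < e`. -/
def D (S : Type) [CommRing S] (N : Type) [AddCommGroup N] [Module S N] (e : ℕ) : Prop :=
  ∀ p : LTSeries (PrimeSpectrum S), p.head ∈ Module.support S N → p.length < e

lemma D.mono_supp {e : ℕ} (h : D S A e) (hs : Module.support S B ⊆ Module.support S A) : D S B e :=
  fun p hp => h p (hs hp)

lemma D.inj {e : ℕ} (h : D S A e) (f : B →ₗ[S] A) (hf : Function.Injective f) : D S B e :=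
  h.mono_supp (Module.support_subset_of_injective f hf)

lemma D.surj {e : ℕ} (h : D S A e) (f : A →ₗ[S] B) (hf : Function.Surjective f) : D S B e :=
  h.mono_supp (Module.support_subset_of_surjective f hf)

lemma D.mono {e e' : ℕ} (h : D S A e) (he : e ≤ e') : D S A e' := fun p hp => (h p hp).trans_le he

lemma D.zero (h : D S A 0) : Subsingleton A := by
  rw [← Module.support_eq_empty_iff (R := S), Set.eq_empty_iff_forall_notMem]
  intro P hP
  exact absurd (h (RelSeries.singleton _ P) hP) (by simp)

lemma D.of_subsing (h : Subsingleton A) (e : ℕ) : D S A e := by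
  intro p hp
  rw [Module.support_eq_empty] at hp
  exact absurd hp (Set.notMem_empty _)

lemma D.exact {e : ℕ} (f : A →ₗ[S] B) (g : B →ₗ[S] C) (h : Function.Exact f g) (hA : D S A e) (hC : D S C e) : D S B e := by
  intro p hp
  by_cases hpA : p.head ∈ Module.support S A
  · exact hA p hpA
  by_cases hpC : p.head ∈ Module.support S C
  · exact hC p hpC
  exfalso
  rw [Module.notMem_support_iff'] at hpA hpC
  rw [Module.mem_support_iff'] at hp
  obtain ⟨m, hm⟩ := hp
  obtain ⟨r, hr, hr'⟩ := hpC (g m)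
  rw [← map_smul] at hr'
  obtain ⟨n, hn⟩ := (h _).1 hr'
  obtain ⟨s, hs, hs'⟩ := hpA n
  refine hm (s * r) (fun hh => ?_) ?_
  · rcases p.head.2.mem_or_mem hh with h | h
    · exact hs h
    · exact hr h
  · rw [mul_smul, ← hn, ← map_smul, hs', map_zero]

lemma D.drop {e : ℕ} (h : D S A (e+1)) (f : S) (l : A →ₗ[S] B) [IsLocalizedModule (Submonoid.powers f) l] :
    D S (B ⧸ LinearMap.range l) e := by
  intro p hp
  rw [Module.mem_support_iff'] at hp
  obtain ⟨x, hx⟩ := hp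
  obtain ⟨u, rfl⟩ := Submodule.Quotient.mk_surjective _ x
  have hb := loc_bij A f l
  obtain ⟨⟨m, ⟨_, t, rfl⟩⟩, hm⟩ := IsLocalizedModule.surj (Submonoid.powers f) l u
  have hm : f ^ t • u = l m := hm
  have hf : f ^ t ∈ p.head.asIdeal := by
    by_contra hc
    refine hx _ hc ?_
    rw [← Submodule.Quotient.mk_smul, Submodule.Quotient.mk_eq_zero, hm]
    exact ⟨m, rfl⟩
  have hle : Ideal.torsionOf S B u ≤ p.head.asIdeal := by
    intro a ha
    by_contra hc
    refine hx _ hc ?_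
    have : a • u = 0 := ha
    rw [← Submodule.Quotient.mk_smul, this, Submodule.Quotient.mk_zero]
  obtain ⟨P, hP, hPle⟩ := Ideal.exists_minimalPrimes_le hle
  have hfP : f ∉ P := by
    intro hfP
    obtain ⟨y, hy, hxy⟩ := Ideal.exists_mul_mem_of_mem_minimalPrimes hP hfP
    apply hy
    have h1 : (f * y) • u = 0 := hxy
    rw [mul_smul] at h1
    exact hb.1 (by simpa using h1)
  have hPp : P.IsPrime := hP.1.1
  let P' : PrimeSpectrum S := ⟨P, hPp⟩
  have hlt : P' < p.head := by
    refine lt_of_le_of_ne hPle ?_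
    intro he
    rw [← he] at hf
    exact hfP (hPp.mem_of_pow_mem _ hf)
  have := h (p.cons P' hlt) ?_
  · simp at this; omega
  · rw [RelSeries.head_cons, Module.mem_support_iff']
    refine ⟨m, fun r hr h0 => hr ?_⟩
    refine hP.1.2 ?_
    change r • u = 0
    have h1 : f ^ t • (r • u) = 0 := by
      rw [smul_comm, hm, ← map_smul, h0, map_zero]
    exact (bij_pow hb t).1 (by simpa using h1)

lemma D.self {n : ℕ} (h : ringKrullDim S = n) : D S S (n+1) := by
  intro p _
  have : (p.length : WithBot ℕ∞) ≤ n := by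
    rw [← h]; exact Order.LTSeries.length_le_krullDim p
  have : p.length ≤ n := by exact_mod_cast this
  omega

variable (I : Ideal S)

lemma LL_subsing (h : Subsingleton A) (k : ℕ) : Subsingleton (LL I A k) := by
  apply LL.subsing
  intro t x
  refine ⟨t, le_refl t, ?_⟩
  have h1 : x.comp (mk0 (LinearMap.id : A →ₗ[S] A)) (add_zero k) = x := Abelian.Ext.comp_mk₀_id x
  have : (LinearMap.id : A →ₗ[S] A) = 0 := by ext a; exact Subsingleton.elim _ _
  rw [← h1, this, mk0_zero, Abelian.Ext.comp_zero, map_zero]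

theorem D_LL [IsNoetherianRing S] {r : ℕ} (f : Fin r → S) (hI : I = Ideal.span (Set.range f)) (c : ℕ) :
    ∀ (Q : Finset (Fin r)) (hQ : Q.card + c = r) (N : Type) [AddCommGroup N] [Module S N]
      (hN : ∀ i ∈ Q, ∀ m : N, ∃ t : ℕ, f i ^ t • m = 0) (e : ℕ) (hD : D S N e) (k : ℕ), D S (LL I N k) (e - k) := by
  induction c with
  | zero =>
    intro Q hQ N _ _ hN e hD k
    have hQu : Q = Finset.univ := by
      rw [← Finset.card_eq_iff_eq_univ, Fintype.card_fin]; omega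
    cases k with
    | zero => exact hD.inj (LL.ev I N) (LL.ev_inj I N)
    | succ k =>
      refine D.of_subsing (LL_zero_of_tors I ?_ k) _
      intro m
      rw [← mem_ker_pi I N f hI, LinearMap.mem_ker]
      funext i
      exact (loc_zero N (f i) (nl N f i) m).2 (hN i (by rw [hQu]; exact Finset.mem_univ i) m)
  | succ c ih =>
    intro Q hQ N _ _ hN e hD k
    cases e with
    | zero => exact D.of_subsing (LL_subsing I hD.zero k) _
    | succ e =>
    obtain ⟨i, hi⟩ : ∃ i, i ∉ Q := by
      by_contra hc
      push Not at hc
      have : Q = Finset.univ := Finset.eq_univ_iff_forall.2 hc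
      rw [this, Finset.card_univ, Fintype.card_fin] at hQ
      omega
    let l := nl N f i
    have hb := loc_bij N (f i) l
    have hfI : f i ∈ I := by rw [hI]; exact Ideal.subset_span ⟨i, rfl⟩
    have hQ' : (insert i Q).card + c = r := by rw [Finset.card_insert_of_notMem hi]; omega
    have hz := LL_zero_of_loc I hfI hb
    have d1 := ih (insert i Q) hQ' (LinearMap.ker l) (by
      rintro j hj ⟨m, hm⟩
      rw [Finset.mem_insert] at hj
      rcases hj with rfl | hj
      · obtain ⟨t, ht⟩ := (loc_zero N (f j) l m).1 hm
        exact ⟨t, Subtype.ext ht⟩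
      · obtain ⟨t, ht⟩ := hN j hj m
        exact ⟨t, Subtype.ext ht⟩) (e+1) (hD.inj _ (Submodule.subtype_injective _)) k
    have d2 := ih (insert i Q) hQ' (Nf N f i ⧸ LinearMap.range l) (by
      rintro j hj x
      obtain ⟨u, rfl⟩ := Submodule.Quotient.mk_surjective _ x
      obtain ⟨⟨m, ⟨_, t, rfl⟩⟩, hm⟩ := IsLocalizedModule.surj (Submonoid.powers (f i)) l u
      have hm : f i ^ t • u = l m := hm
      rw [Finset.mem_insert] at hj
      rcases hj with rfl | hj
      · refine ⟨t, ?_⟩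
        rw [← Submodule.Quotient.mk_smul, Submodule.Quotient.mk_eq_zero, hm]
        exact ⟨m, rfl⟩
      · obtain ⟨t', ht⟩ := hN j hj m
        refine ⟨t', ?_⟩
        have h1 : f i ^ t • (f j ^ t' • u) = 0 := by
          rw [smul_comm, hm, ← map_smul, ht, map_zero]
        have h2 : f j ^ t' • u = 0 := (bij_pow hb t).1 (by simpa using h1)
        rw [← Submodule.Quotient.mk_smul, h2, Submodule.Quotient.mk_zero]) e (hD.drop (f i) l)
    have d3 : D S (LL I (LinearMap.range l) k) (e + 1 - k) := by
      cases k with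
      | zero =>
        refine D.of_subsing ⟨fun a b => ?_⟩ _
        have : ∀ a : LL I (LinearMap.range l) 0, a = 0 := by
          intro a
          apply LL.ev_inj
          rw [map_zero]
          obtain ⟨t, ht⟩ := (LL.mem_range_ev I _ _).1 (⟨a, rfl⟩ : LL.ev I _ a ∈ LinearMap.range (LL.ev I (LinearMap.range l)))
          have h2 := ht _ (Ideal.pow_mem_pow hfI t)
          apply Subtype.ext
          have h3 := congrArg Subtype.val h2
          exact (bij_pow hb t).1 (by simpa using h3)
        rw [this a, this b]
      | succ k =>
        obtain ⟨e1⟩ := bij_conn_of I _ _ (exact_range_mkQ l) Subtype.val_injective (Submodule.mkQ_surjective _) k (k+1) rfl (hz k) (hz (k+1))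
        have := (d2 k).inj e1.symm.toLinearMap e1.symm.injective
        rwa [Nat.add_sub_add_right]
    exact D.exact _ _ (LL.ex2 I _ _ (exact_ker_rangeRestrict l) Subtype.val_injective (LinearMap.surjective_rangeRestrict _) k) d1 d3

end P6
end LyuV



namespace LyuV

section P7a
open TensorProduct

variable {S : Type} [CommRing S] [IsNoetherianRing S] [IsLocalRing S] {n : ℕ} {x : Fin n → S}
  {T : Type} [CommRing T] [Algebra S T] {K : Type} [Field K] {c : K →+* T} {M : Ideal T}

lemma CT.ff (hT : CT S T K c M) [Module.Flat S T] : Module.FaithfullyFlat S T where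
  submodule_ne_top := by
    intro m hm h
    rw [IsLocalRing.eq_maximalIdeal hm] at h
    have h1 : algebraMap S T 1 ∈ M ^ 1 := by
      rw [pow_one, hT.map, ← Submodule.restrictScalars_mem S, ← Ideal.smul_top_eq_map, h]
      trivial
    have := hT.t2 1 1 h1
    rw [pow_one] at this
    exact (maximalIdeal.isMaximal S).ne_top ((Ideal.eq_top_iff_one _).2 this)

lemma CT.torsEquiv (hT : CT S T K c M) [Module.Flat S T] {N : Type} [AddCommGroup N] [Module S N]
    (hN : Tors (maximalIdeal S) N) : Function.Bijective (TensorProduct.mk S T N 1) := by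
  have := hT.ff
  constructor
  · rw [injective_iff_map_eq_zero]
    intro m hm
    exact (Module.FaithfullyFlat.one_tmul_eq_zero_iff S N (A := T) m).1 hm
  · intro z
    induction z using TensorProduct.induction_on with
    | zero => exact ⟨0, map_zero _⟩
    | add a b ha hb =>
      obtain ⟨a, rfl⟩ := ha
      obtain ⟨b, rfl⟩ := hb
      exact ⟨a + b, map_add _ _ _⟩
    | tmul τ m =>
      obtain ⟨t, ht⟩ := hN m
      obtain ⟨s, hs⟩ := hT.t1 τ t
      refine ⟨s • m, ?_⟩
      have key : ∀ z ∈ M ^ t, z ⊗ₜ[S] m = 0 := by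
        intro z hz
        rw [hT.map, ← Ideal.map_pow] at hz
        induction hz using Submodule.span_induction with
        | mem z hz =>
          obtain ⟨a, ha, rfl⟩ := hz
          rw [Algebra.algebraMap_eq_smul_one, TensorProduct.smul_tmul, ht a ha, TensorProduct.tmul_zero]
        | zero => exact TensorProduct.zero_tmul _ _
        | add a b _ _ ha hb => rw [TensorProduct.add_tmul, ha, hb, add_zero]
        | smul r a _ ha =>
          have := congrArg (fun q => r • q) ha
          simpa [TensorProduct.smul_tmul'] using this
      have h2 := key _ hs
      rw [TensorProduct.sub_tmul, sub_eq_zero] at h2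
      rw [h2, TensorProduct.mk_apply, ← TensorProduct.smul_tmul, Algebra.algebraMap_eq_smul_one]

/-- coregularity -/
def Coreg (x : Fin n → S) (N : Type) [AddCommGroup N] [Module S N] : Prop :=
  ∀ (J : Finset (Fin n)) (i : Fin n), i ∉ J → ∀ m : N, (∀ j ∈ J, x j • m = 0) →
    ∃ v : N, (∀ j ∈ J, x j • v = 0) ∧ x i • v = m

lemma coreg_of_HH (hx : RSP S n x) (hT : CT S T K c M) [Module.Flat S T] (φ : Fin n → (T →+* PowerSeries T))
    (hφ : ∀ i j, φ i (algebraMap S T (x j)) = PowerSeries.C (algebraMap S T (x j)) + if i = j then PowerSeries.X else 0)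
    {N : Type} [AddCommGroup N] [Module S N]
    (hN : Tors (maximalIdeal S) N) (hH : ∀ i, HH (φ i) S N) : Coreg x N := by
  intro J i hi m hm
  obtain ⟨E, hE⟩ := hH i
  let e : N ≃ₗ[S] T ⊗[S] N := LinearEquiv.ofBijective _ (hT.torsEquiv hN)
  have hEj : ∀ j, j ≠ i → ∀ z s, E (x j • z) s = x j • E z s := by
    intro j hj z s
    rw [← algebraMap_smul T (x j) z, map_smul, Tw.smul_apply, hφ, if_neg (Ne.symm hj), add_zero, Finset.sum_eq_single (0, s)]
    · simp
    · rintro ⟨a, b⟩ h h'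
      have h := Finset.HasAntidiagonal.mem_antidiagonal.1 h
      have : a ≠ 0 := by
        rintro rfl
        apply h'
        simp at h; rw [h]
      simp [PowerSeries.coeff_C, this]
    · intro h; exact absurd (Finset.HasAntidiagonal.mem_antidiagonal.2 (zero_add s)) h
  have hEi : ∀ z s, E (x i • z) (s+1) = x i • E z (s+1) + E z s := by
    intro z s
    rw [← algebraMap_smul T (x i) z, map_smul, Tw.smul_apply, hφ, if_pos rfl]
    simp only [map_add, add_smul, Finset.sum_add_distrib]
    congr 1
    · rw [Finset.sum_eq_single (0, s+1)]
      · simp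
      · rintro ⟨a, b⟩ h h'
        have h := Finset.HasAntidiagonal.mem_antidiagonal.1 h
        have : a ≠ 0 := by
          rintro rfl
          apply h'
          simp at h; rw [h]
        simp [PowerSeries.coeff_C, this]
      · intro h; exact absurd (Finset.HasAntidiagonal.mem_antidiagonal.2 (zero_add (s+1))) h
    · rw [Finset.sum_eq_single (1, s)]
      · simp
      · rintro ⟨a, b⟩ h h'
        have h := Finset.HasAntidiagonal.mem_antidiagonal.1 h
        have : a ≠ 1 := by
          rintro rfl
          apply h'
          have : b = s := by simp at h; omega
          rw [this]
        simp [PowerSeries.coeff_X, this]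
      · intro h; exact absurd (Finset.HasAntidiagonal.mem_antidiagonal.2 (add_comm 1 s)) h
  have key : ∀ (a : ℕ) (s : ℕ) (z : T ⊗[S] N), (∀ j ∈ J, x j • z = 0) →
      ∃ v : T ⊗[S] N, (∀ j ∈ J, x j • v = 0) ∧ E (x i ^ a • z) (s + a) = E z s + x i • v := by
    intro a
    induction a with
    | zero => intro s z hz; exact ⟨0, fun j _ => smul_zero _, by simp⟩
    | succ a ih =>
      intro s z hz
      obtain ⟨v, hv, h⟩ := ih (s+1) (x i • z) (fun j hj => by rw [smul_comm, hz j hj, smul_zero])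
      refine ⟨E z (s+1) + v, fun j hj => ?_, ?_⟩
      · have hji : j ≠ i := by rintro rfl; exact hi hj
        rw [smul_add, hv j hj, add_zero, ← hEj j hji, hz j hj, map_zero]; rfl
      · rw [pow_succ, mul_smul, show s + (a+1) = s + 1 + a by omega, h, hEi, smul_add]
        abel
  obtain ⟨t, ht⟩ := hN m
  obtain ⟨v, hv, h⟩ := key t 0 (e m) (fun j hj => by rw [← map_smul, hm j hj, map_zero])
  have h0 : x i ^ t • e m = 0 := by
    rw [← map_smul, ht _ (Ideal.pow_mem_pow (hx.mem i) t), map_zero]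
  rw [h0, map_zero, hE] at h
  have h : (0 : T ⊗[S] N) = e m + x i • v := h
  refine ⟨- e.symm v, fun j hj => ?_, ?_⟩
  · rw [smul_neg, ← map_smul, hv j hj, map_zero, neg_zero]
  · apply e.injective
    rw [smul_neg, map_neg, map_smul, e.apply_symm_apply]
    exact (eq_neg_of_add_eq_zero_left h.symm).symm

end P7a
end LyuV



namespace LyuV

section P7b
open CategoryTheory.Abelian Limits

variable {S : Type} [CommRing S]
variable {A B C X : Type} [AddCommGroup A] [Module S A] [AddCommGroup B] [Module S B]
  [AddCommGroup C] [Module S C] [AddCommGroup X] [Module S X]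

/-- vanishing of Ext -/
def EZ (S : Type) [CommRing S] (A B : Type) [AddCommGroup A] [Module S A] [AddCommGroup B] [Module S B] (k : ℕ) : Prop :=
  ∀ z : E (S := S) A B k, z = 0

lemma EZ.congr_left {k : ℕ} (e : A ≃ₗ[S] B) (h : EZ S B X k) : EZ S A X k := by
  intro z
  have h1 : (mk0 (LinearMap.id : A →ₗ[S] A)).comp z (zero_add k) = z := Abelian.Ext.mk₀_id_comp z
  rw [← h1]
  exact pre_factor e.toLinearMap e.symm.toLinearMap _ (by ext a; simp) z (h _)

lemma EZ.congr_right {k : ℕ} (e : A ≃ₗ[S] B) (h : EZ S X B k) : EZ S X A k := by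
  intro z
  have h1 : z.comp (mk0 (LinearMap.id : A →ₗ[S] A)) (add_zero k) = z := Abelian.Ext.comp_mk₀_id z
  have : (LinearMap.id : A →ₗ[S] A) = e.symm.toLinearMap ∘ₗ e.toLinearMap := by ext a; simp
  rw [← h1, this, ← post_post, h (z.comp (mk0 e.toLinearMap) (add_zero k)), Abelian.Ext.zero_comp]

lemma EZ.of_subsing_right {k : ℕ} (h : Subsingleton B) : EZ S A B k := by
  intro z
  have h1 : z.comp (mk0 (LinearMap.id : B →ₗ[S] B)) (add_zero k) = z := Abelian.Ext.comp_mk₀_id z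
  have : (LinearMap.id : B →ₗ[S] B) = 0 := by ext a; exact Subsingleton.elim _ _
  rw [← h1, this, mk0_zero, Abelian.Ext.comp_zero]

lemma EZ.of_subsing_left {k : ℕ} (h : Subsingleton A) : EZ S A B k := by
  intro z
  have h1 : (mk0 (LinearMap.id : A →ₗ[S] A)).comp z (zero_add k) = z := Abelian.Ext.mk₀_id_comp z
  have : (LinearMap.id : A →ₗ[S] A) = 0 := by ext a; exact Subsingleton.elim _ _
  rw [← h1, this, mk0_zero, Abelian.Ext.zero_comp]

lemma EZ.proj {k : ℕ} [Module.Projective S A] : EZ S A B (k+1) := by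
  intro z
  have : Projective (ModuleCat.of S A) := (IsProjective.iff_projective A).1 inferInstance
  exact Abelian.Ext.eq_zero_of_projective _

section ses

lemma EZ.mid (f : A →ₗ[S] B) (g : B →ₗ[S] C) (h : Function.Exact f g)
    (hf : Function.Injective f) (hg : Function.Surjective g) {k : ℕ} (h1 : EZ S X A k) (h2 : EZ S X C k) : EZ S X B k := by
  intro z
  obtain ⟨y, hy⟩ := Abelian.Ext.covariant_sequence_exact₂ _ (sc_se f g h hf hg) z (h2 _)
  rw [← hy, h1 y, Abelian.Ext.zero_comp]

lemma EZ.left (f : A →ₗ[S] B) (g : B →ₗ[S] C) (h : Function.Exact f g)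
    (hf : Function.Injective f) (hg : Function.Surjective g) {k : ℕ} (h1 : EZ S X B (k+1)) (h2 : EZ S X C k) : EZ S X A (k+1) := by
  intro z
  obtain ⟨y, hy⟩ := Abelian.Ext.covariant_sequence_exact₁ _ (sc_se f g h hf hg) z (h1 _) rfl
  rw [← hy, h2 y, Abelian.Ext.zero_comp]

lemma EZ.mid' (f : A →ₗ[S] B) (g : B →ₗ[S] C) (h : Function.Exact f g)
    (hf : Function.Injective f) (hg : Function.Surjective g) {k : ℕ} (h1 : EZ S A X k) (h2 : EZ S C X k) : EZ S B X k := by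
  intro z
  obtain ⟨y, hy⟩ := Abelian.Ext.contravariant_sequence_exact₂ (sc_se f g h hf hg) _ z (h1 _)
  rw [← hy, h2 y, Abelian.Ext.comp_zero]

end ses

section coreg
variable [IsNoetherianRing S] [IsLocalRing S] {n : ℕ} {x : Fin n → S}

/-- the quotient by part of the system of parameters -/
abbrev AQ (x : Fin n → S) (J : Finset (Fin n)) : Type := S ⧸ Ideal.span (x '' (J : Set (Fin n)))

/-- multiplication on AQ -/
noncomputable abbrev mulx (x : Fin n → S) (J : Finset (Fin n)) (i : Fin n) : AQ x J →ₗ[S] AQ x J := x i • LinearMap.id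

lemma AQ.le (x : Fin n → S) (J : Finset (Fin n)) (i : Fin n) : Ideal.span (x '' (J : Set (Fin n))) ≤ Ideal.span (x '' ((insert i J : Finset (Fin n)) : Set (Fin n))) :=
  Ideal.span_mono (Set.image_mono (by simp))

/-- projection -/
noncomputable abbrev prx (x : Fin n → S) (J : Finset (Fin n)) (i : Fin n) : AQ x J →ₗ[S] AQ x (insert i J) :=
  Submodule.mapQ _ _ LinearMap.id (AQ.le x J i)

lemma mulx_inj (hx : RSP S n x) (J : Finset (Fin n)) (i : Fin n) (hi : i ∉ J) : Function.Injective (mulx x J i) := by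
  rw [injective_iff_map_eq_zero]
  intro a ha
  obtain ⟨a, rfl⟩ := Submodule.Quotient.mk_surjective _ a
  have ha : (Submodule.Quotient.mk (x i • a) : AQ x J) = 0 := ha
  rw [Submodule.Quotient.mk_eq_zero] at ha ⊢
  exact hx.colon J i hi a ha

lemma prx_surj (J : Finset (Fin n)) (i : Fin n) : Function.Surjective (prx x J i) := by
  intro a
  obtain ⟨a, rfl⟩ := Submodule.Quotient.mk_surjective _ a
  exact ⟨Submodule.Quotient.mk a, rfl⟩

lemma mulx_exact (J : Finset (Fin n)) (i : Fin n) : Function.Exact (mulx x J i) (prx x J i) := by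
  intro a
  obtain ⟨a, rfl⟩ := Submodule.Quotient.mk_surjective _ a
  change (Submodule.Quotient.mk a : AQ x (insert i J)) = 0 ↔ _
  rw [Submodule.Quotient.mk_eq_zero, Finset.coe_insert, Set.image_insert_eq, Ideal.mem_span_insert]
  constructor
  · rintro ⟨b, z, hz, rfl⟩
    refine ⟨Submodule.Quotient.mk b, ?_⟩
    change (Submodule.Quotient.mk (x i • b) : AQ x J) = _
    rw [Submodule.Quotient.eq]
    have : x i • b - (b * x i + z) = - z := by rw [smul_eq_mul]; ring
    rw [this]
    exact neg_mem hz
  · rintro ⟨b, hb⟩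
    obtain ⟨b, rfl⟩ := Submodule.Quotient.mk_surjective _ b
    have hb : (Submodule.Quotient.mk (x i • b) : AQ x J) = Submodule.Quotient.mk a := hb
    rw [Submodule.Quotient.eq] at hb
    refine ⟨b, a - b * x i, ?_, by ring⟩
    have : a - b * x i = - (x i • b - a) := by rw [smul_eq_mul]; ring
    rw [this]
    exact neg_mem hb

lemma coreg_EZ (hx : RSP S n x) {N : Type} [AddCommGroup N] [Module S N] (hN : Coreg x N) (J : Finset (Fin n)) :
    ∀ k, EZ S (AQ x J) N (k+1) := by
  induction J using Finset.induction_on with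
  | empty =>
    intro k
    have e : AQ x ∅ ≃ₗ[S] S := Submodule.quotEquivOfEqBot _ (by simp)
    exact EZ.congr_left e EZ.proj
  | insert i J hi ih =>
    intro k z
    have hse := sc_se _ _ (mulx_exact J i) (mulx_inj hx J i hi) (prx_surj J i)
    obtain ⟨y, hy⟩ := Abelian.Ext.contravariant_sequence_exact₃ hse _ z (ih k _) (add_comm 1 k)
    cases k with
    | succ k => rw [← hy, ih k y, Abelian.Ext.comp_zero]
    | zero =>
      obtain ⟨ψ, hψ⟩ : ∃ ψ : AQ x J →ₗ[S] N, mk0 ψ = y := ⟨_, mk0_E0 y⟩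
      obtain ⟨v, hv, hvm⟩ := hN J i hi (ψ (Submodule.Quotient.mk 1)) (by
        intro j hj
        rw [← map_smul, ← Submodule.Quotient.mk_smul]
        have : (Submodule.Quotient.mk (x j • (1 : S)) : AQ x J) = 0 := by
          rw [Submodule.Quotient.mk_eq_zero, smul_eq_mul, mul_one]
          exact Ideal.subset_span ⟨j, hj, rfl⟩
        rw [this, map_zero])
      let ψ' : AQ x J →ₗ[S] N := Submodule.liftQ _ (LinearMap.toSpanSingleton S N v) (by
        change Ideal.span _ ≤ _
        rw [Ideal.span_le]
        rintro _ ⟨j, hj, rfl⟩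
        exact hv j hj)
      have e : ψ = ψ' ∘ₗ mulx x J i := by
        apply Submodule.linearMap_qext
        ext
        change ψ (Submodule.Quotient.mk 1) = (x i • (1 : S)) • v
        rw [smul_eq_mul, mul_one, hvm]
      have h0 : hse.extClass.comp (mk0 (mulx x J i)) (add_zero 1) = 0 := hse.extClass_comp
      rw [← hy, ← hψ, e, ← mk0_comp_mk0]
      have h3 := Abelian.Ext.comp_assoc hse.extClass (mk0 (mulx x J i)) (mk0 ψ') (add_zero 1) (add_zero 0) (add_zero 1)
      rw [h0, Abelian.Ext.zero_comp] at h3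
      exact h3.symm

noncomputable def AQ_univ (hx : RSP S n x) : ResidueField S ≃ₗ[S] AQ x Finset.univ :=
  Submodule.quotEquivOfEq _ _ (by rw [Finset.coe_univ, Set.image_univ, hx.span])

lemma coreg_K (hx : RSP S n x) {N : Type} [AddCommGroup N] [Module S N] (hN : Coreg x N) (k : ℕ) :
    EZ S (ResidueField S) N (k+1) := EZ.congr_left (AQ_univ hx) (coreg_EZ hx hN Finset.univ k)

end coreg

lemma HH.ker_coker1 {T : Type} [CommRing T] [Algebra S T] (φ : T →+* PowerSeries T) [Module.Flat S T] (hφ : ∀ z, PowerSeries.constantCoeff (φ z) = z)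
    (f : S) {N N' : Type} [AddCommGroup N] [Module S N] [AddCommGroup N'] [Module S N']
    (l : N →ₗ[S] N') [IsLocalizedModule (Submonoid.powers f) l] (h : HH φ S N) :
    HH φ S (LinearMap.ker l) ∧ HH φ S (N' ⧸ LinearMap.range l) := by
  obtain ⟨h1, h2⟩ := HH.ker_coker φ hφ (fun _ : Fin 1 => f) (fun _ => N') (fun _ => l) h
  constructor
  · refine HH.equiv φ (LinearEquiv.ofEq _ _ ?_) h1
    ext m
    simp only [LinearMap.mem_ker]
    constructor
    · intro h; exact congrFun h 0
    · intro h; funext i; exact h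
  · refine HH.equiv φ (Submodule.Quotient.equiv _ _ (LinearEquiv.funUnique (Fin 1) S N') ?_) h2
    ext m
    constructor
    · rintro ⟨_, ⟨a, rfl⟩, rfl⟩
      exact ⟨a, rfl⟩
    · rintro ⟨a, rfl⟩
      exact ⟨_, ⟨a, rfl⟩, rfl⟩

lemma kill_K [IsLocalRing S] (a : S) (ha : a ∈ maximalIdeal S) (z : ResidueField S) : a • z = 0 := by
  rw [Algebra.smul_def]
  have : algebraMap S (ResidueField S) a = 0 := (residue_eq_zero_iff a).2 ha
  rw [this, zero_mul]

theorem main_EZ [IsNoetherianRing S] [IsLocalRing S] {n : ℕ} {x : Fin n → S} (hx : RSP S n x)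
    {T : Type} [CommRing T] [Algebra S T] {K : Type} [Field K] {c : K →+* T} {M : Ideal T} (hT : CT S T K c M) [Module.Flat S T]
    (φ : Fin n → (T →+* PowerSeries T)) (hφ0 : ∀ i z, PowerSeries.constantCoeff (φ i z) = z)
    (hφ : ∀ i j, φ i (algebraMap S T (x j)) = PowerSeries.C (algebraMap S T (x j)) + if i = j then PowerSeries.X else 0)
    (c : ℕ) :
    ∀ (Q : Finset (Fin n)) (hQ : Q.card + c = n) (N : Type) [AddCommGroup N] [Module S N]
      (hH : ∀ i, HH (φ i) S N)
      (hN : ∀ i ∈ Q, ∀ m : N, ∃ t : ℕ, x i ^ t • m = 0) (e : ℕ) (hD : D S N e) (k : ℕ) (hk : e ≤ k), EZ S (ResidueField S) N k := by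
  induction c with
  | zero =>
    intro Q hQ N _ _ hH hN e hD k hk
    cases e with
    | zero => exact EZ.of_subsing_right hD.zero
    | succ e =>
    have hQu : Q = Finset.univ := by
      rw [← Finset.card_eq_iff_eq_univ, Fintype.card_fin]; omega
    have hTo : Tors (maximalIdeal S) N := by
      intro m
      rw [← mem_ker_pi _ N x hx.span.symm, LinearMap.mem_ker]
      funext i
      exact (loc_zero N (x i) (nl N x i) m).2 (hN i (by rw [hQu]; exact Finset.mem_univ i) m)
    obtain ⟨k, rfl⟩ : ∃ k', k = k' + 1 := ⟨k - 1, by omega⟩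
    exact coreg_K hx (coreg_of_HH hx hT φ hφ hTo hH) k
  | succ c ih =>
    intro Q hQ N _ _ hH hN e hD k hk
    cases e with
    | zero => exact EZ.of_subsing_right hD.zero
    | succ e =>
    obtain ⟨k, rfl⟩ : ∃ k', k = k' + 1 := ⟨k - 1, by omega⟩
    obtain ⟨i, hi⟩ : ∃ i, i ∉ Q := by
      by_contra hc
      push Not at hc
      have : Q = Finset.univ := Finset.eq_univ_iff_forall.2 hc
      rw [this, Finset.card_univ, Fintype.card_fin] at hQ
      omega
    let l := nl N x i
    have hb := loc_bij N (x i) l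
    have hQ' : (insert i Q).card + c = n := by rw [Finset.card_insert_of_notMem hi]; omega
    have hz : ∀ k, EZ S (ResidueField S) (Nf N x i) k := fun k z =>
      E_zero_of_kill (x i) (kill_K _ (hx.mem i)) hb z
    have d1 := ih (insert i Q) hQ' (LinearMap.ker l) (fun j => (HH.ker_coker1 (φ j) (hφ0 j) (x i) l (hH j)).1) (by
      rintro j hj ⟨m, hm⟩
      rw [Finset.mem_insert] at hj
      rcases hj with rfl | hj
      · obtain ⟨t, ht⟩ := (loc_zero N (x j) l m).1 hm
        exact ⟨t, Subtype.ext ht⟩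
      · obtain ⟨t, ht⟩ := hN j hj m
        exact ⟨t, Subtype.ext ht⟩) (e+1) (hD.inj _ (Submodule.subtype_injective _)) (k+1) hk
    have d2 := ih (insert i Q) hQ' (Nf N x i ⧸ LinearMap.range l) (fun j => (HH.ker_coker1 (φ j) (hφ0 j) (x i) l (hH j)).2) (by
      rintro j hj y
      obtain ⟨u, rfl⟩ := Submodule.Quotient.mk_surjective _ y
      obtain ⟨⟨m, ⟨_, t, rfl⟩⟩, hm⟩ := IsLocalizedModule.surj (Submonoid.powers (x i)) l u
      have hm : x i ^ t • u = l m := hm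
      rw [Finset.mem_insert] at hj
      rcases hj with rfl | hj
      · refine ⟨t, ?_⟩
        rw [← Submodule.Quotient.mk_smul, Submodule.Quotient.mk_eq_zero, hm]
        exact ⟨m, rfl⟩
      · obtain ⟨t', ht⟩ := hN j hj m
        refine ⟨t', ?_⟩
        have h1 : x i ^ t • (x j ^ t' • u) = 0 := by
          rw [smul_comm, hm, ← map_smul, ht, map_zero]
        have h2 : x j ^ t' • u = 0 := (bij_pow hb t).1 (by simpa using h1)
        rw [← Submodule.Quotient.mk_smul, h2, Submodule.Quotient.mk_zero]) e (hD.drop (x i) l) k (by omega)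
    have d3 : EZ S (ResidueField S) (LinearMap.range l) (k+1) :=
      EZ.left _ _ (exact_range_mkQ l) Subtype.val_injective (Submodule.mkQ_surjective _) (hz (k+1)) d2
    exact EZ.mid _ _ (exact_ker_rangeRestrict l) Subtype.val_injective (LinearMap.surjective_rangeRestrict _) d1 d3

end P7b
end LyuV



namespace LyuV

section P8
open CategoryTheory.Abelian Limits

variable {S : Type} [CommRing S] [IsNoetherianRing S] [IsLocalRing S] {n : ℕ} {x : Fin n → S}

lemma smul_K_zero {B : Type} [AddCommGroup B] [Module S B] {k : ℕ} (a : S) (ha : a ∈ maximalIdeal S)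
    (z : E (S := S) (ResidueField S) B k) : a • z = 0 := by
  rw [smul_eq_pre]
  have : (a • LinearMap.id : ResidueField S →ₗ[S] ResidueField S) = 0 := by
    apply LinearMap.ext
    intro w
    exact kill_K a ha w
  rw [this, mk0_zero, Abelian.Ext.zero_comp]

lemma K_AQ (hx : RSP S n x) : ∀ (k : ℕ) (J : Finset (Fin n)), k + J.card < n → EZ S (ResidueField S) (AQ x J) k := by
  intro k
  induction k with
  | zero =>
    intro J hJ z
    obtain ⟨i, hi⟩ : ∃ i, i ∉ J := by
      by_contra hc
      push Not at hc
      have : J = Finset.univ := Finset.eq_univ_of_forall hc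
      rw [this, Finset.card_univ, Fintype.card_fin] at hJ
      omega
    have h1 := smul_K_zero (x i) (hx.mem i) z
    rw [smul_eq_post, ← mk0_E0 z, mk0_comp_mk0, ← mk0_zero] at h1
    have h2 := mk0_inj h1
    have h3 : E0 z = 0 := by
      apply LinearMap.ext
      intro w
      apply mulx_inj hx J i hi
      rw [LinearMap.zero_apply, map_zero]
      exact LinearMap.congr_fun h2 w
    rw [← mk0_E0 z, h3, mk0_zero]
  | succ k ih =>
    intro J hJ z
    obtain ⟨i, hi⟩ : ∃ i, i ∉ J := by
      by_contra hc
      push Not at hc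
      have : J = Finset.univ := Finset.eq_univ_of_forall hc
      rw [this, Finset.card_univ, Fintype.card_fin] at hJ
      omega
    have h1 := smul_K_zero (x i) (hx.mem i) z
    rw [smul_eq_post] at h1
    obtain ⟨y, hy⟩ := Abelian.Ext.covariant_sequence_exact₁ _ (sc_se _ _ (mulx_exact J i) (mulx_inj hx J i hi) (prx_surj J i)) z h1 rfl
    have hy0 := ih (insert i J) (by rw [Finset.card_insert_of_notMem hi]; omega) y
    rw [← hy, hy0, Abelian.Ext.zero_comp]

lemma K_S (hx : RSP S n x) (k : ℕ) (hk : k < n) : EZ S (ResidueField S) S k := by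
  have e : AQ x ∅ ≃ₗ[S] S := Submodule.quotEquivOfEqBot _ (by simp)
  exact EZ.congr_right e.symm (K_AQ hx k ∅ (by simpa using hk))

lemma D.quot_prime {e : ℕ} (p : Ideal S) [hp : p.IsPrime] (y : S) (hy : y ∉ p) (h : D S (S ⧸ p) (e+1)) :
    D S (S ⧸ (p ⊔ Ideal.span {y})) e := by
  intro q hq
  have h1 : p ⊔ Ideal.span {y} ≤ q.head.asIdeal := by
    have := Module.annihilator_le_of_mem_support hq
    rwa [Ideal.annihilator_quotient] at this
  have hlt : (⟨p, hp⟩ : PrimeSpectrum S) < q.head := by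
    refine lt_of_le_of_ne (le_sup_left.trans h1) ?_
    intro hc
    apply hy
    have : y ∈ q.head.asIdeal := h1 (Ideal.mem_sup_right (Ideal.mem_span_singleton_self y))
    rw [← hc] at this
    exact this
  have h2 := h (q.cons ⟨p, hp⟩ hlt) (by
    rw [RelSeries.head_cons, Module.mem_support_iff_of_finite, Ideal.annihilator_quotient])
  simpa using h2

lemma quot_ses (p : Ideal S) [hp : p.IsPrime] (y : S) (hy : y ∉ p) :
    Function.Injective (y • LinearMap.id : (S ⧸ p) →ₗ[S] (S ⧸ p)) ∧
    Function.Exact (y • LinearMap.id : (S ⧸ p) →ₗ[S] (S ⧸ p)) (Submodule.factor (le_sup_left : p ≤ p ⊔ Ideal.span {y})) := by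
  constructor
  · rw [injective_iff_map_eq_zero]
    intro a ha
    obtain ⟨a, rfl⟩ := Submodule.Quotient.mk_surjective _ a
    have ha : (Submodule.Quotient.mk (y • a) : S ⧸ p) = 0 := ha
    rw [Submodule.Quotient.mk_eq_zero] at ha ⊢
    exact (hp.mem_or_mem ha).resolve_left hy
  · intro a
    obtain ⟨a, rfl⟩ := Submodule.Quotient.mk_surjective _ a
    change (Submodule.Quotient.mk a : S ⧸ (p ⊔ Ideal.span {y})) = 0 ↔ _
    rw [Submodule.Quotient.mk_eq_zero, sup_comm, Ideal.mem_span_singleton_sup]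
    constructor
    · rintro ⟨b, z, hz, rfl⟩
      refine ⟨Submodule.Quotient.mk b, ?_⟩
      change (Submodule.Quotient.mk (y • b) : S ⧸ p) = _
      rw [Submodule.Quotient.eq]
      have : y • b - (b * y + z) = - z := by rw [smul_eq_mul]; ring
      rw [this]
      exact neg_mem hz
    · rintro ⟨b, hb⟩
      obtain ⟨b, rfl⟩ := Submodule.Quotient.mk_surjective _ b
      have hb : (Submodule.Quotient.mk (y • b) : S ⧸ p) = Submodule.Quotient.mk a := hb
      rw [Submodule.Quotient.eq] at hb
      refine ⟨b, a - b * y, ?_, by ring⟩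
      have : a - b * y = - (y • b - a) := by rw [smul_eq_mul]; ring
      rw [this]
      exact neg_mem hb

lemma grade_EZ (hx : RSP S n x) : ∀ (e : ℕ) (N : Type) [AddCommGroup N] [Module S N] [Module.Finite S N],
    D S N e → ∀ k, k + e ≤ n → EZ S N S k := by
  intro e
  induction e with
  | zero => intro N _ _ _ h k _; exact EZ.of_subsing_left h.zero
  | succ e ih =>
    intro N _ _ hfin
    refine IsNoetherianRing.induction_on_isQuotientEquivQuotientPrime S hfin
      (motive := fun N [AddCommGroup N] [Module S N] [Module.Finite S N] =>
        D S N (e+1) → ∀ k, k + (e+1) ≤ n → EZ S N S k) ?_ ?_ ?_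
    · intro N _ _ _ hN _ k _
      exact EZ.of_subsing_left hN
    · intro N _ _ _ p e1 hD k hk
      refine EZ.congr_left e1 ?_
      have hD := hD.surj e1.toLinearMap e1.surjective
      have hp := p.2
      by_cases hpm : p.asIdeal = maximalIdeal S
      · exact EZ.congr_left (Submodule.quotEquivOfEq _ _ hpm) (K_S hx k (by omega))
      · obtain ⟨y, hym, hyp⟩ : ∃ y ∈ maximalIdeal S, y ∉ p.asIdeal := by
          by_contra hc
          push Not at hc
          exact hpm (le_antisymm (IsLocalRing.le_maximalIdeal hp.ne_top) hc)
        have hE := ih _ (hD.quot_prime p.asIdeal y hyp) (1 + k) (by omega)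
        obtain ⟨hi, hex⟩ := quot_ses p.asIdeal y hyp
        have hse := sc_se _ _ hex hi (Submodule.factor_surjective _)
        have hfe : Module.Finite S (E (S := S) (S ⧸ p.asIdeal) S k) :=
          ModuleCat.finite_ext S (ModuleCat.of S (S ⧸ p.asIdeal)) (ModuleCat.of S S) k
        have hdiv : ∀ z : E (S := S) (S ⧸ p.asIdeal) S k, ∃ w : E (S := S) (S ⧸ p.asIdeal) S k, y • w = z := by
          intro z
          obtain ⟨w, hw⟩ := Abelian.Ext.contravariant_sequence_exact₁ hse _ z rfl (hE _)
          exact ⟨w, (smul_eq_pre y w).trans hw⟩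
        have hbot : (⊤ : Submodule S (E (S := S) (S ⧸ p.asIdeal) S k)) = ⊥ := by
          refine Submodule.eq_bot_of_le_smul_of_le_jacobson_bot (maximalIdeal S) _ hfe.fg_top ?_
            (by rw [IsLocalRing.jacobson_eq_maximalIdeal _ bot_ne_top])
          intro z _
          obtain ⟨w, rfl⟩ := hdiv z
          exact Submodule.smul_mem_smul hym trivial
        intro z
        have : z ∈ (⊤ : Submodule S (E (S := S) (S ⧸ p.asIdeal) S k)) := trivial
        rw [hbot] at this
        exact this
    · intro A _ _ _ B _ _ _ C _ _ _ f g hf hg hex hA hC hD k hk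
      exact EZ.mid' f g hex hf hg (hA (hD.inj f hf) k hk) (hC (hD.surj g hg) k hk)

lemma D.quot_pow (I : Ideal S) (d : ℕ) (hd : ringKrullDim (S ⧸ I) = d) (t : ℕ) : D S (S ⧸ I ^ t) (d+1) := by
  intro q hq
  have h1 : I ≤ q.head.asIdeal := by
    have := Module.annihilator_le_of_mem_support hq
    rw [Ideal.annihilator_quotient] at this
    exact q.head.2.le_of_pow_le this
  rw [ringKrullDim_quotient] at hd
  let q' : LTSeries (PrimeSpectrum.zeroLocus (I : Set S)) :=
    { length := q.length
      toFun := fun i => ⟨q i, h1.trans (LTSeries.head_le q i)⟩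
      step := fun i => q.step i }
  have h2 : (q'.length : WithBot ℕ∞) ≤ d := by
    rw [← hd]; exact Order.LTSeries.length_le_krullDim q'
  have h3 : q'.length ≤ d := by exact_mod_cast h2
  have : q'.length = q.length := rfl
  omega

lemma LL_zero (hx : RSP S n x) (I : Ideal S) (d : ℕ) (hd : ringKrullDim (S ⧸ I) = d) (k : ℕ) (hk : k + (d+1) ≤ n) :
    Subsingleton (LL I S k) := by
  apply LL.subsing
  intro t z
  exact ⟨t, le_rfl, by rw [grade_EZ hx (d+1) _ (D.quot_pow I d hd t) k hk z, map_zero]⟩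

lemma main_gt (hx : RSP S n x) (F : Type) [Field F] [Algebra F S] (hdim : ringKrullDim S = n) (I : Ideal S)
    (i j : ℕ) (hj : j ≤ n) (hij : j < i) : EZ S (ResidueField S) (LL I S (n - j)) i := by
  obtain ⟨g, hg⟩ := exists_coeff_field (S := S) F
  have hT := CT_adic g hg
  choose φ hφ0 hφ using fun i => hT.exists_HS hx i
  obtain ⟨r, f, hf⟩ := Submodule.fg_iff_exists_fin_generating_family.1 (IsNoetherian.noetherian I)
  have hf' : I = Ideal.span (Set.range f) := hf.symm
  refine main_EZ hx hT φ hφ0 hφ n ∅ (by simp) _ (fun l => HH_LL I f hf' (φ l) (hφ0 l) _ _ (HH.self (φ l) (hφ0 l)))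
    (by simp) _ (D_LL I f hf' r ∅ (by simp) S (by simp) _ (D.self hdim) (n-j)) i (by omega)

lemma exists_RSP (hdim : ringKrullDim S = n)
    (hreg : ∃ s : Finset S, s.card = n ∧ Ideal.span (s : Set S) = maximalIdeal S) : ∃ x, RSP S n x := by
  obtain ⟨s, hs, h⟩ := hreg
  refine ⟨fun i => ((s.equivFinOfCardEq hs).symm i : S), ⟨?_, hdim.ge⟩⟩
  rw [← h]
  congr 1
  ext a
  constructor
  · rintro ⟨i, rfl⟩
    exact Finset.coe_mem _
  · intro ha
    exact ⟨s.equivFinOfCardEq hs ⟨a, ha⟩, by simp⟩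

theorem final (F : Type) [Field F] [Algebra F S]
    (n : ℕ) (hdim : ringKrullDim S = n)
    (hreg : ∃ s : Finset S, s.card = n ∧ Ideal.span (s : Set S) = maximalIdeal S)
    (I : Ideal S) (d : ℕ) (hd : ringKrullDim (S ⧸ I) = d)
    (i j : ℕ) (hj : j ≤ n) (h : d < j ∨ j < i) :
    Subsingleton (OExt (ModuleCat.of S (ResidueField S)) ((localCohomology I (n - j)).obj (ModuleCat.of S S)) i) := by
  obtain ⟨x, hx⟩ := exists_RSP hdim hreg
  have h1 : EZ S (ResidueField S) (LL I S (n - j)) i := by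
    rcases h with h | h
    · exact EZ.of_subsing_right (LL_zero hx I d hd (n - j) (by omega))
    · exact main_gt hx F hdim I i j hj h
  obtain ⟨e⟩ := LL.equivLC_aux I (n - j) (ModuleCat.of S S)
  have h2 : EZ S (ResidueField S) ((localCohomology I (n - j)).obj (ModuleCat.of S S) : Type) i :=
    EZ.congr_right e.symm h1
  refine ⟨fun a b => (LyuV.cmp _ _ i).injective ?_⟩
  exact (h2 _).trans (h2 _).symm

end P8
end LyuV

/-- Vanishing of Lyubeznik numbers: if `R = S/I` is a `d`-dimensional local ring, where
`(S,𝔪,K)` is an `n`-dimensional regular local ring containing a field, then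
`λ_{i,j}(R) = dim_K Ext^i_S(K, H^{n−j}_I(S))` vanishes whenever `j > d` or `i > j`. -/
theorem lyubeznik_number_vanishing
    {S : Type} [CommRing S] [IsNoetherianRing S] [IsLocalRing S]
    (F : Type) [Field F] [Algebra F S]
    (n : ℕ) (hdim : ringKrullDim S = n)
    (hreg : ∃ s : Finset S, s.card = n ∧ Ideal.span (s : Set S) = maximalIdeal S)
    (I : Ideal S) (d : ℕ) (hd : ringKrullDim (S ⧸ I) = d)
    (i j : ℕ) (hj : j ≤ n) (h : d < j ∨ j < i) :
    Subsingleton ((((Ext S (ModuleCat S) i).obj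
        (op (ModuleCat.of S (ResidueField S)))).obj
      ((localCohomology I (n - j)).obj (ModuleCat.of S S))) : Type) := by
  exact LyuV.final F n hdim hreg I d hd i j hj h
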